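/- Every holomorphic motion h of X over 𝔻 extends to a holomorphic motion of the whole complex plane: there exists a holomorphic motion H : 𝔻 × ℂ → ℂ of ℂ over 𝔻 with H(λ, x) = h(λ, x) for all λ ∈ 𝔻 and x ∈ X (Słodkowski's extended λ-lemma). -/

import Mathlib

/-- A holomorphic motion of a set `A ⊆ ℂ` over the unit disk `𝔻` (with basepoint `0`),
modelled as a total map `h : ℂ → ℂ → ℂ` whose restriction to `𝔻 × A` is the motion:
`h 0 x = x` on `A`, each time-`λ` map is injective on `A`, and each trajectory
`λ ↦ h λ x` is holomorphic on `𝔻`. -/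
def IsHolomorphicMotion (A : Set ℂ) (h : ℂ → ℂ → ℂ) : Prop :=
  (∀ x ∈ A, h 0 x = x) ∧
  (∀ l ∈ Metric.ball (0 : ℂ) 1, Set.InjOn (h l) A) ∧
  (∀ x ∈ A, DifferentiableOn ℂ (fun l => h l x) (Metric.ball (0 : ℂ) 1))

section Kernel

open MeasureTheory Filter Topology Metric

/-- Bounded Borel measurable functions on the plane. -/
structure BddMeasurable (f : ℂ → ℂ) : Prop where
  measurable : Measurable f
  bounded : ∃ C, ∀ w, ‖f w‖ ≤ C

/-- A kernel with uniformly bounded `L¹` norms satisfying, off the diagonals, the identity that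
makes the associated integral operator a Rota-Baxter operator of weight zero. -/
structure IsRotaBaxterKernel (N : ℂ → ℂ → ℂ) (M : ℝ) : Prop where
  measurable : Measurable (Function.uncurry N)
  integrable : ∀ z, Integrable (N z)
  integral_norm_le : ∀ z, ∫ w, ‖N z w‖ ≤ M
  mul_eq : ∀ z w ζ, w ≠ ζ → z ≠ w → z ≠ ζ → N z w * N z ζ = N z w * N w ζ + N z ζ * N ζ w

/-- The integral operator with kernel `N`. -/
noncomputable def kernelOp (N : ℂ → ℂ → ℂ) (f : ℂ → ℂ) (z : ℂ) : ℂ := ∫ w, N z w * f w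

namespace BddMeasurable

variable {f g : ℂ → ℂ}

lemma const (c : ℂ) : BddMeasurable fun _ => c := ⟨measurable_const, ‖c‖, fun _ => le_rfl⟩

lemma mul (hf : BddMeasurable f) (hg : BddMeasurable g) : BddMeasurable fun w => f w * g w := by
  obtain ⟨C, hC⟩ := hf.bounded
  obtain ⟨D, hD⟩ := hg.bounded
  refine ⟨hf.measurable.mul hg.measurable, C * D, fun w => ?_⟩
  rw [norm_mul]
  exact mul_le_mul (hC w) (hD w) (norm_nonneg _) ((norm_nonneg _).trans (hC w))

lemma add (hf : BddMeasurable f) (hg : BddMeasurable g) : BddMeasurable fun w => f w + g w := by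
  obtain ⟨C, hC⟩ := hf.bounded
  obtain ⟨D, hD⟩ := hg.bounded
  exact ⟨hf.measurable.add hg.measurable, C + D,
    fun w => (norm_add_le _ _).trans (add_le_add (hC w) (hD w))⟩

lemma neg (hf : BddMeasurable f) : BddMeasurable fun w => -f w := by
  simpa using (const (-1)).mul hf

lemma sub (hf : BddMeasurable f) (hg : BddMeasurable g) : BddMeasurable fun w => f w - g w := by
  simpa [sub_eq_add_neg] using hf.add hg.neg

lemma pow (hf : BddMeasurable f) : ∀ n : ℕ, BddMeasurable fun w => f w ^ n
  | 0 => by simpa using const 1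
  | n + 1 => by simpa [pow_succ] using (pow hf n).mul hf

lemma cexp (hf : BddMeasurable f) : BddMeasurable fun w => Complex.exp (f w) := by
  obtain ⟨C, hC⟩ := hf.bounded
  refine ⟨Complex.measurable_exp.comp hf.measurable, Real.exp C, fun w => ?_⟩
  exact (Complex.norm_exp_le_exp_norm _).trans (Real.exp_le_exp.2 (hC w))

end BddMeasurable

namespace IsRotaBaxterKernel

variable {N : ℂ → ℂ → ℂ} {M : ℝ} {a f g : ℂ → ℂ}

lemma nonneg (hN : IsRotaBaxterKernel N M) : 0 ≤ M :=
  (integral_nonneg fun _ => norm_nonneg _).trans (hN.integral_norm_le 0)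

lemma integrable_mul (hN : IsRotaBaxterKernel N M) (hf : BddMeasurable f) (z : ℂ) :
    Integrable fun w => N z w * f w := by
  obtain ⟨C, hC⟩ := hf.bounded
  exact (hN.integrable z).mul_bdd hf.measurable.aestronglyMeasurable (ae_of_all _ hC)

lemma integral_norm_mul_le (hN : IsRotaBaxterKernel N M) (hf : BddMeasurable f) {C : ℝ}
    (hC : ∀ w, ‖f w‖ ≤ C) (z : ℂ) : ∫ w, ‖N z w * f w‖ ≤ M * C := by
  calc ∫ w, ‖N z w * f w‖ ≤ ∫ w, ‖N z w‖ * C := by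
        refine integral_mono (hN.integrable_mul hf z).norm ((hN.integrable z).norm.mul_const C)
          fun w => ?_
        simp only [norm_mul]
        exact mul_le_mul_of_nonneg_left (hC w) (norm_nonneg _)
    _ ≤ M * C := by
        rw [integral_mul_const]
        exact mul_le_mul_of_nonneg_right (hN.integral_norm_le z) ((norm_nonneg _).trans (hC 0))

lemma norm_kernelOp_le (hN : IsRotaBaxterKernel N M) (hf : BddMeasurable f) {C : ℝ}
    (hC : ∀ w, ‖f w‖ ≤ C) (z : ℂ) : ‖kernelOp N f z‖ ≤ M * C :=
  (norm_integral_le_integral_norm _).trans (hN.integral_norm_mul_le hf hC z)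

lemma bddMeasurable_kernelOp (hN : IsRotaBaxterKernel N M) (hf : BddMeasurable f) :
    BddMeasurable (kernelOp N f) := by
  obtain ⟨C, hC⟩ := hf.bounded
  refine ⟨?_, M * C, hN.norm_kernelOp_le hf hC⟩
  have : Measurable (Function.uncurry fun z w => N z w * f w) :=
    hN.measurable.mul (hf.measurable.comp measurable_snd)
  exact this.stronglyMeasurable.integral_prod_right.measurable

lemma kernelOp_add (hN : IsRotaBaxterKernel N M) (hf : BddMeasurable f) (hg : BddMeasurable g)
    (z : ℂ) : kernelOp N (fun w => f w + g w) z = kernelOp N f z + kernelOp N g z := by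
  simp only [kernelOp, mul_add]
  exact integral_add (hN.integrable_mul hf z) (hN.integrable_mul hg z)

lemma kernelOp_sub (hN : IsRotaBaxterKernel N M) (hf : BddMeasurable f) (hg : BddMeasurable g)
    (z : ℂ) : kernelOp N (fun w => f w - g w) z = kernelOp N f z - kernelOp N g z := by
  simp only [kernelOp, mul_sub]
  exact integral_sub (hN.integrable_mul hf z) (hN.integrable_mul hg z)

lemma _root_.kernelOp_const_mul (c : ℂ) (f : ℂ → ℂ) (z : ℂ) :
    kernelOp N (fun w => c * f w) z = c * kernelOp N f z := by
  simp only [kernelOp, mul_left_comm _ c]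
  exact integral_const_mul _ _

lemma integrable_prod (hN : IsRotaBaxterKernel N M) (hf : BddMeasurable f) (hg : BddMeasurable g)
    (z : ℂ) :
    Integrable (fun p : ℂ × ℂ => (N z p.1 * f p.1) * (N p.1 p.2 * g p.2))
      (volume.prod volume) := by
  obtain ⟨D, hD⟩ := hg.bounded
  have h1 : Measurable fun p : ℂ × ℂ => N z p.1 :=
    hN.measurable.comp (measurable_const.prodMk measurable_fst)
  have hmeas : Measurable fun p : ℂ × ℂ => (N z p.1 * f p.1) * (N p.1 p.2 * g p.2) :=
    (h1.mul (hf.measurable.comp measurable_fst)).mul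
      (hN.measurable.mul (hg.measurable.comp measurable_snd))
  rw [integrable_prod_iff hmeas.aestronglyMeasurable]
  refine ⟨ae_of_all _ fun w => (hN.integrable_mul hg w).const_mul (N z w * f w), ?_⟩
  refine ((hN.integrable_mul hf z).norm.mul_const (M * D)).mono'
    hmeas.norm.stronglyMeasurable.integral_prod_right.aestronglyMeasurable
    (ae_of_all _ fun w => ?_)
  rw [Real.norm_of_nonneg (integral_nonneg fun _ => norm_nonneg _)]
  simp only [norm_mul (N z w * f w)]
  rw [integral_const_mul]
  exact mul_le_mul_of_nonneg_left (hN.integral_norm_mul_le hg hD w) (norm_nonneg _)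

/-- The Rota-Baxter identity of weight zero. -/
lemma kernelOp_mul_kernelOp (hN : IsRotaBaxterKernel N M) (hf : BddMeasurable f)
    (hg : BddMeasurable g) (z : ℂ) :
    kernelOp N f z * kernelOp N g z =
      kernelOp N (fun w => f w * kernelOp N g w) z
        + kernelOp N (fun w => g w * kernelOp N f w) z := by
  have hA := hN.integrable_prod hf hg z
  have hB := (hN.integrable_prod hg hf z).swap
  have hne : ∀ c : ℂ, ∀ᵐ w : ℂ, w ≠ c := fun c => by
    simp [ae_iff]
  calc kernelOp N f z * kernelOp N g z
      = ∫ w, ∫ ζ, (N z w * f w) * (N z ζ * g ζ) := by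
        simp only [integral_const_mul, integral_mul_const, kernelOp]
    _ = ∫ w, ∫ ζ, ((N z w * f w) * (N w ζ * g ζ) + (N z ζ * g ζ) * (N ζ w * f w)) := by
        refine integral_congr_ae ?_
        filter_upwards [hne z] with w hw
        refine integral_congr_ae ?_
        filter_upwards [hne z, hne w] with ζ hζ hζw
        linear_combination (f w * g ζ) * hN.mul_eq z w ζ hζw.symm hw.symm hζ.symm
    _ = (∫ w, ∫ ζ, (N z w * f w) * (N w ζ * g ζ))
          + ∫ ζ, ∫ w, (N z ζ * g ζ) * (N ζ w * f w) := by
        have h1 := integral_prod _ (hA.add hB)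
        have h2 := integral_add hA hB
        have h3 := integral_prod _ hA
        have h4 := integral_prod_symm _ hB
        simp only [Pi.add_apply, Function.comp_apply, Prod.fst_swap, Prod.snd_swap]
          at h1 h2 h3 h4
        rw [← h3, ← h4, ← h2, h1]
    _ = _ := by
        simp only [integral_const_mul, kernelOp, mul_assoc]

lemma kernelOp_pow (hN : IsRotaBaxterKernel N M) (ha : BddMeasurable a) (n : ℕ) (z : ℂ) :
    kernelOp N a z ^ (n + 1) = (n + 1) * kernelOp N (fun w => a w * kernelOp N a w ^ n) z := by
  have hS := hN.bddMeasurable_kernelOp ha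
  induction n generalizing z with
  | zero => simp
  | succ n ih =>
    have key := hN.kernelOp_mul_kernelOp (ha.mul (hS.pow n)) ha z
    have e1 : (fun w => a w * kernelOp N a w ^ n * kernelOp N a w)
        = fun w => a w * kernelOp N a w ^ (n + 1) := by
      funext w; ring
    have e2 : ∀ w, kernelOp N (fun w => a w * kernelOp N a w ^ n) w
        = ((n : ℂ) + 1)⁻¹ * kernelOp N a w ^ (n + 1) := by
      intro w
      rw [ih w, inv_mul_cancel_left₀ (Nat.cast_add_one_ne_zero n)]
    have e3 : (fun w => a w * kernelOp N (fun w => a w * kernelOp N a w ^ n) w)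
        = fun w => ((n : ℂ) + 1)⁻¹ * (a w * kernelOp N a w ^ (n + 1)) := by
      funext w; rw [e2]; ring
    rw [e1, e3, kernelOp_const_mul] at key
    have hn : (n : ℂ) + 1 ≠ 0 := Nat.cast_add_one_ne_zero n
    rw [pow_succ, ih, mul_assoc, key]
    push_cast
    field_simp

lemma polynomial_eval_kernelOp (hN : IsRotaBaxterKernel N M) (ha : BddMeasurable a)
    (P : Polynomial ℂ) (z : ℂ) :
    BddMeasurable (fun w => P.eval (kernelOp N a w)) ∧
    P.eval (kernelOp N a z) =
      P.eval 0 + kernelOp N (fun w => a w * P.derivative.eval (kernelOp N a w)) z := by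
  have hS := hN.bddMeasurable_kernelOp ha
  have hP : ∀ P : Polynomial ℂ, BddMeasurable fun w => P.eval (kernelOp N a w) := fun P => by
    induction P using Polynomial.induction_on' with
    | add p q hp hq => simpa using hp.add hq
    | monomial n c => simpa using (BddMeasurable.const c).mul (hS.pow n)
  refine ⟨hP P, ?_⟩
  induction P using Polynomial.induction_on' with
  | add p q hp hq =>
    simp only [Polynomial.eval_add, Polynomial.derivative_add, mul_add]
    rw [hN.kernelOp_add (ha.mul (hP _)) (ha.mul (hP _)), hp, hq]
    ring
  | monomial n c =>
    cases n with
    | zero => simp [kernelOp]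
    | succ n =>
      simp only [Polynomial.eval_monomial, Polynomial.derivative_monomial, Nat.add_sub_cancel]
      have e : (fun w => a w * (c * ((n + 1 : ℕ) : ℂ) * kernelOp N a w ^ n))
          = fun w => (c * ((n : ℂ) + 1)) * (a w * kernelOp N a w ^ n) := by
        funext w; push_cast; ring
      rw [e, kernelOp_const_mul, hN.kernelOp_pow ha]
      simp
      ring

/-- The chain rule for the integral operator of a Rota-Baxter kernel. -/
lemma comp_kernelOp (hN : IsRotaBaxterKernel N M) (ha : BddMeasurable a) {G : ℂ → ℂ} {R ρ : ℝ}
    (hR : ∀ w, ‖kernelOp N a w‖ ≤ R) (hRρ : R < ρ) (hG : DifferentiableOn ℂ G (ball 0 ρ)) :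
    BddMeasurable (fun w => deriv G (kernelOp N a w)) ∧
    ∀ z, G (kernelOp N a z) = G 0 + kernelOp N (fun w => a w * deriv G (kernelOp N a w)) z := by
  have hS := hN.bddMeasurable_kernelOp ha
  have hR0 : 0 ≤ R := (norm_nonneg _).trans (hR 0)
  set φ := kernelOp N a with hφ
  have hmem : ∀ w, φ w ∈ closedBall (0 : ℂ) R := fun w => by simpa using hR w
  have hsub : closedBall (0 : ℂ) R ⊆ ball 0 ρ := closedBall_subset_ball hRρ
  obtain ⟨ρ', hρ', hρρ'⟩ := exists_between hRρ
  have hρ'0 : 0 < ρ' := hR0.trans_lt hρ'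
  lift ρ' to NNReal using hρ'0.le
  have hps := (hG.mono (closedBall_subset_ball hρρ')).hasFPowerSeriesOnBall
    (by exact_mod_cast hρ'0)
  set p := cauchyPowerSeries G 0 ρ'
  let P : ℕ → Polynomial ℂ := fun n => ∑ k ∈ Finset.range n, Polynomial.monomial k (p.coeff k)
  have hPp : ∀ n y, (P n).eval y = p.partialSum n y := fun n y => by
    simp [P, Polynomial.eval_finsetSum, FormalMultilinearSeries.partialSum, mul_comm]
  have hlim : TendstoLocallyUniformlyOn (fun n y => (P n).eval y) G atTop (ball 0 ρ') := by
    have := hps.tendstoLocallyUniformlyOn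
    simpa [hPp, Metric.eball_coe] using this
  have hlim' : TendstoLocallyUniformlyOn (fun n y => (P n).derivative.eval y) (deriv G) atTop
      (ball 0 ρ') := by
    have := hlim.deriv (Eventually.of_forall fun n => (P n).differentiable.differentiableOn)
      isOpen_ball
    refine this.congr fun n y _ => ?_
    simp [Function.comp]
  have hsub' : closedBall (0 : ℂ) R ⊆ ball 0 ρ' := closedBall_subset_ball hρ'
  have hU := (tendstoLocallyUniformlyOn_iff_tendstoUniformlyOn_of_compact
    (isCompact_closedBall (0 : ℂ) R)).1 (hlim'.mono hsub')
  have hG'c : ContinuousOn (deriv G) (closedBall 0 R) :=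
    ((hG.deriv isOpen_ball).continuousOn).mono hsub
  have hG' : BddMeasurable fun w => deriv G (φ w) := by
    obtain ⟨C, hC⟩ := (isCompact_closedBall (0 : ℂ) R).exists_bound_of_continuousOn hG'c
    exact ⟨(measurable_deriv G).comp hS.measurable, C, fun w => hC _ (hmem w)⟩
  refine ⟨hG', fun z => ?_⟩
  have h1 : Tendsto (fun n => (P n).eval (φ z)) atTop (𝓝 (G (φ z))) :=
    hlim.tendsto_at (hsub' (hmem z))
  have h0 : Tendsto (fun n => (P n).eval 0) atTop (𝓝 (G 0)) :=
    hlim.tendsto_at (mem_ball_self hρ'0)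
  have h2 : Tendsto (fun n => kernelOp N (fun w => a w * (P n).derivative.eval (φ w)) z) atTop
      (𝓝 (kernelOp N (fun w => a w * deriv G (φ w)) z)) := by
    obtain ⟨A, hA⟩ := ha.bounded
    have hA0 : 0 ≤ A := (norm_nonneg _).trans (hA 0)
    rw [Metric.tendsto_atTop]
    intro ε hε
    have hδ : 0 < ε / (M * A + 1) := div_pos hε (by have := mul_nonneg hN.nonneg hA0; linarith)
    obtain ⟨n₀, hn₀⟩ := eventually_atTop.1 (Metric.tendstoUniformlyOn_iff.1 hU _ hδ)
    refine ⟨n₀, fun n hn => ?_⟩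
    have hPn := (hN.polynomial_eval_kernelOp ha (P n).derivative 0).1
    rw [dist_eq_norm, ← hN.kernelOp_sub (ha.mul hPn) (ha.mul hG')]
    have hle := hN.norm_kernelOp_le (C := A * (ε / (M * A + 1)))
      ((ha.mul hPn).sub (ha.mul hG')) (fun w => ?_) z
    · refine hle.trans_lt ?_
      have hMA := mul_nonneg hN.nonneg hA0
      rw [← mul_assoc, mul_div_assoc', div_lt_iff₀ (by linarith)]
      nlinarith
    · rw [← mul_sub, norm_mul]
      refine mul_le_mul (hA w) ?_ (norm_nonneg _) hA0
      have := hn₀ n hn (φ w) (hmem w)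
      rw [dist_comm, dist_eq_norm] at this
      exact this.le
  refine tendsto_nhds_unique h1 ((h0.add h2).congr fun n => ?_)
  exact (hN.polynomial_eval_kernelOp ha (P n) z).2.symm

lemma exp_kernelOp (hN : IsRotaBaxterKernel N M) (ha : BddMeasurable a) (z : ℂ) :
    Complex.exp (-kernelOp N a z) =
      1 - kernelOp N (fun w => a w * Complex.exp (-kernelOp N a w)) z := by
  obtain ⟨R, hR⟩ := (hN.bddMeasurable_kernelOp ha).bounded
  have hd : ∀ x : ℂ, HasDerivAt (fun x => Complex.exp (-x)) (-Complex.exp (-x)) x := fun x => by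
    simpa using (hasDerivAt_neg x).cexp
  have h := (hN.comp_kernelOp (G := fun x => Complex.exp (-x)) ha hR (lt_add_one R)
    fun x _ => (hd x).differentiableAt.differentiableWithinAt).2 z
  have e : (fun w => a w * deriv (fun x => Complex.exp (-x)) (kernelOp N a w))
      = fun w => (-1) * (a w * Complex.exp (-kernelOp N a w)) := by
    funext w; rw [(hd _).deriv]; ring
  rw [e, kernelOp_const_mul] at h
  simpa [sub_eq_add_neg] using h

/-- Explicit resolution of the linear equation `u = k + S (a u)`. -/
lemma exp_mul_sub_eq (hN : IsRotaBaxterKernel N M) {u k : ℂ → ℂ} (ha : BddMeasurable a)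
    (hu : BddMeasurable u) (hk : BddMeasurable k)
    (h : ∀ z, u z = k z + kernelOp N (fun w => a w * u w) z) (z : ℂ) :
    Complex.exp (-kernelOp N a z) * (u z - k z) =
      kernelOp N (fun w => a w * Complex.exp (-kernelOp N a w) * k w) z := by
  have hE : BddMeasurable fun w => Complex.exp (-kernelOp N a w) :=
    (hN.bddMeasurable_kernelOp ha).neg.cexp
  have haE := ha.mul hE
  have key := hN.kernelOp_mul_kernelOp haE (ha.mul hu) z
  have hv : ∀ w, kernelOp N (fun w => a w * u w) w = u w - k w := fun w => by rw [h w]; ring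
  have he : ∀ w, kernelOp N (fun w => a w * Complex.exp (-kernelOp N a w)) w
      = 1 - Complex.exp (-kernelOp N a w) := fun w => by rw [hN.exp_kernelOp ha w]; ring
  simp only [hv, he] at key
  rw [← hN.kernelOp_add (haE.mul (hu.sub hk)) ((ha.mul hu).mul ((BddMeasurable.const 1).sub hE))]
    at key
  have e : (fun w => a w * Complex.exp (-kernelOp N a w) * (u w - k w)
        + a w * u w * (1 - Complex.exp (-kernelOp N a w)))
      = fun w => a w * u w - a w * Complex.exp (-kernelOp N a w) * k w := by
    funext w; ring
  rw [e, hN.kernelOp_sub (ha.mul hu) (haE.mul hk), hv] at key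
  linear_combination -key

lemma ne_zero_of_eq_const_add (hN : IsRotaBaxterKernel N M) {u : ℂ → ℂ} {c : ℂ}
    (ha : BddMeasurable a) (hu : BddMeasurable u) (hc : c ≠ 0)
    (h : ∀ z, u z = c + kernelOp N (fun w => a w * u w) z) (z : ℂ) : u z ≠ 0 := by
  have key := hN.exp_mul_sub_eq ha hu (BddMeasurable.const c) h z
  have e : (fun w => a w * Complex.exp (-kernelOp N a w) * c)
      = fun w => c * (a w * Complex.exp (-kernelOp N a w)) := by
    funext w; ring
  have he := hN.exp_kernelOp ha z
  rw [e, kernelOp_const_mul] at key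
  intro h0
  rw [h0] at key
  exact hc (by linear_combination -c * he - key)

lemma norm_le_of_eq_add (hN : IsRotaBaxterKernel N M) {u k : ℂ → ℂ} {A K : ℝ}
    (ha : BddMeasurable a) (hu : BddMeasurable u) (hk : BddMeasurable k)
    (hA : ∀ w, ‖a w‖ ≤ A) (hK : ∀ w, ‖k w‖ ≤ K)
    (h : ∀ z, u z = k z + kernelOp N (fun w => a w * u w) z) (z : ℂ) :
    ‖u z‖ ≤ (1 + Real.exp (M * A) * (M * (A * Real.exp (M * A)))) * K := by
  have key := hN.exp_mul_sub_eq ha hu hk h z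
  have hA0 : 0 ≤ A := (norm_nonneg _).trans (hA 0)
  have hE : BddMeasurable fun w => Complex.exp (-kernelOp N a w) :=
    (hN.bddMeasurable_kernelOp ha).neg.cexp
  have hS := hN.norm_kernelOp_le ha hA
  have hEb : ∀ w, ‖Complex.exp (-kernelOp N a w)‖ ≤ Real.exp (M * A) := fun w =>
    (Complex.norm_exp_le_exp_norm _).trans (Real.exp_le_exp.2 (by simpa using hS w))
  have hb := hN.norm_kernelOp_le (C := A * Real.exp (M * A) * K) ((ha.mul hE).mul hk)
    (fun w => ?_) z
  · have e : u z = k z + Complex.exp (kernelOp N a z)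
        * kernelOp N (fun w => a w * Complex.exp (-kernelOp N a w) * k w) z := by
      rw [← key, ← mul_assoc, ← Complex.exp_add]
      simp
    rw [e]
    refine (norm_add_le _ _).trans ?_
    rw [add_mul, one_mul, norm_mul]
    refine add_le_add (hK z) ?_
    calc _ ≤ Real.exp (M * A) * (M * (A * Real.exp (M * A) * K)) :=
          mul_le_mul ((Complex.norm_exp_le_exp_norm _).trans (Real.exp_le_exp.2 (hS z))) hb
            (norm_nonneg _) (Real.exp_nonneg _)
      _ = _ := by ring
  · rw [norm_mul, norm_mul]
    exact mul_le_mul (mul_le_mul (hA w) (hEb w) (norm_nonneg _) hA0) (hK w) (norm_nonneg _)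
      (by positivity)

end IsRotaBaxterKernel

end Kernel

section Continuation

open Metric Filter Topology

/-- The method of continuity for Lipschitz perturbations of the identity. -/
lemma exists_sub_smul_eq {B : Type*} [NormedAddCommGroup B] [NormedSpace ℝ B] [CompleteSpace B]
    {Θ : B → B} {K C : ℝ} (hΘ : ∀ f g, ‖Θ f - Θ g‖ ≤ K * ‖f - g‖)
    (hC : ∀ s ∈ Set.Icc (0 : ℝ) 1, ∀ f g, ‖f - g‖ ≤ C * ‖(f - s • Θ f) - (g - s • Θ g)‖)
    (y : B) : ∃ f, f - Θ f = y := by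
  rcases subsingleton_or_nontrivial B with hB | hB
  · exact ⟨0, Subsingleton.elim _ _⟩
  obtain ⟨b, hb⟩ := exists_ne (0 : B)
  have hb' : 0 < ‖b - 0‖ := by simpa using hb
  have hK : 0 ≤ K := nonneg_of_mul_nonneg_left ((norm_nonneg _).trans (hΘ b 0)) hb'
  have hC0 : 0 ≤ C := by
    have := hC 0 (by simp) b 0
    simp only [sub_zero, zero_smul] at this hb'
    nlinarith
  have hCK : 0 ≤ C * K := mul_nonneg hC0 hK
  obtain ⟨m, hm⟩ := exists_nat_gt (2 * (C * K))
  have hm0 : (0 : ℝ) < m := by linarith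
  have step : ∀ s ∈ Set.Icc (0 : ℝ) 1, (∀ y, ∃ f, f - s • Θ f = y) →
      ∀ y, ∃ f, f - (s + (m : ℝ)⁻¹) • Θ f = y := by
    intro s hs hsurj y
    choose Ψ hΨ using hsurj
    have hΨL : ∀ p q, ‖Ψ p - Ψ q‖ ≤ C * ‖p - q‖ := fun p q => by
      simpa [hΨ] using hC s hs (Ψ p) (Ψ q)
    let T : B → B := fun g => y + (m : ℝ)⁻¹ • Θ (Ψ g)
    have hT : ContractingWith (1 / 2) T := by
      refine ⟨by rw [← NNReal.coe_lt_coe]; norm_num, LipschitzWith.of_dist_le_mul fun p q => ?_⟩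
      rw [dist_eq_norm, dist_eq_norm]
      have e : T p - T q = (m : ℝ)⁻¹ • (Θ (Ψ p) - Θ (Ψ q)) := by
        simp [T, smul_sub]
      rw [e, norm_smul, Real.norm_of_nonneg (by positivity), inv_mul_le_iff₀ hm0]
      calc ‖Θ (Ψ p) - Θ (Ψ q)‖ ≤ K * (C * ‖p - q‖) :=
            (hΘ _ _).trans (mul_le_mul_of_nonneg_left (hΨL p q) hK)
        _ = (C * K) * ‖p - q‖ := by ring
        _ ≤ (m / 2) * ‖p - q‖ := by gcongr; linarith
        _ = _ := by push_cast; ring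
    let g := hT.fixedPoint
    have hg : y + (m : ℝ)⁻¹ • Θ (Ψ g) = g := hT.fixedPoint_isFixedPt
    refine ⟨Ψ g, ?_⟩
    rw [add_smul, ← sub_sub, hΨ]
    exact sub_eq_of_eq_add hg.symm
  have all : ∀ n : ℕ, n ≤ m → ∀ y, ∃ f, f - ((n : ℝ) * (m : ℝ)⁻¹) • Θ f = y := by
    intro n
    induction n with
    | zero => exact fun _ y => ⟨y, by simp⟩
    | succ n ih =>
      intro hn
      have := step ((n : ℝ) * (m : ℝ)⁻¹) ⟨by positivity, ?_⟩ (ih (by lia))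
      · simpa [add_mul] using this
      · rw [← div_eq_mul_inv, div_le_one hm0]
        exact_mod_cast (by lia : n ≤ m)
  simpa [hm0.ne'] using all m le_rfl y

end Continuation

section CauchyKernel

open MeasureTheory Filter Topology Metric

/-- A continuous nonnegative radial profile supported in `[r, R]`, of mass `1 / 2` for `ρ dρ`. -/
structure RadialBump (r R : ℝ) (κ : ℝ → ℝ) : Prop where
  pos : 0 < r
  lt : r < R
  lt_one : R < 1
  continuous : Continuous κ
  nonneg : ∀ ρ, 0 ≤ κ ρ
  eq_zero_of_le : ∀ ρ ≤ r, κ ρ = 0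
  eq_zero_of_ge : ∀ ρ, R ≤ ρ → κ ρ = 0
  integral_eq : ∫ ρ in Set.Ioi (0 : ℝ), ρ * κ ρ = 1 / 2

lemma exists_radialBump {r R : ℝ} (hr : 0 < r) (hrR : r < R) (hR : R < 1) :
    ∃ κ, RadialBump r R κ := by
  let κ₀ : ℝ → ℝ := fun ρ => max 0 ((ρ - r) * (R - ρ))
  have hc : Continuous κ₀ := by fun_prop
  have h1 : ∀ ρ ≤ r, κ₀ ρ = 0 := fun ρ h => max_eq_left (by nlinarith)
  have h2 : ∀ ρ, R ≤ ρ → κ₀ ρ = 0 := fun ρ h => max_eq_left (by nlinarith)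
  have h0 : ∀ ρ, 0 ≤ κ₀ ρ := fun ρ => le_max_left _ _
  have e : ∫ ρ in Set.Ioi (0 : ℝ), ρ * κ₀ ρ = ∫ ρ in r..R, ρ * κ₀ ρ := by
    rw [intervalIntegral.integral_of_le hrR.le]
    refine setIntegral_eq_of_subset_of_forall_sdiff_eq_zero measurableSet_Ioi
      (fun x hx => hr.trans hx.1) fun x hx => ?_
    rcases le_or_gt x r with h | h
    · rw [h1 x h, mul_zero]
    · rw [h2 x (not_le.1 fun h' => hx.2 ⟨h, h'⟩).le, mul_zero]
  have hI : 0 < ∫ ρ in r..R, ρ * κ₀ ρ := by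
    refine intervalIntegral.intervalIntegral_pos_of_pos_on
      ((continuous_id.mul hc).intervalIntegrable _ _) (fun x hx => ?_) hrR
    exact mul_pos (hr.trans hx.1)
      (lt_max_of_lt_right (mul_pos (sub_pos.2 hx.1) (sub_pos.2 hx.2)))
  refine ⟨fun ρ => (2 * ∫ ρ in r..R, ρ * κ₀ ρ)⁻¹ * κ₀ ρ, hr, hrR, hR, by fun_prop,
    fun ρ => mul_nonneg (by positivity) (h0 ρ), fun ρ h => by rw [h1 ρ h, mul_zero],
    fun ρ h => by rw [h2 ρ h, mul_zero], ?_⟩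
  simp only [mul_left_comm _ (2 * ∫ ρ in r..R, ρ * κ₀ ρ)⁻¹]
  rw [integral_const_mul, e]
  field_simp

/-- The Cauchy kernel, normalised at the origin and weighted by a radial bump. -/
noncomputable def bumpKernel (κ : ℝ → ℝ) (z w : ℂ) : ℂ :=
  (κ ‖w‖ / Real.pi : ℝ) * (z * w / (w - z))

lemma integrableOn_norm_inv : IntegrableOn (fun w : ℂ => ‖w‖⁻¹) (closedBall 0 1) := by
  have : LocallyIntegrable (fun w : ℂ => ‖w‖⁻¹) := by
    refine locallyIntegrable_of_norm_le_rpow (C := 1) (α := 1) (by simp) (by simp)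
      (ae_of_all _ fun x => ?_) (by fun_prop)
    simp [Real.rpow_neg_one]
  exact this.integrableOn_isCompact (isCompact_closedBall _ _)

namespace RadialBump

variable {r R : ℝ} {κ : ℝ → ℝ}

lemma exists_bound (hκ : RadialBump r R κ) : ∃ B, 0 ≤ B ∧ ∀ ρ, κ ρ ≤ B := by
  obtain ⟨B, hB⟩ := (isCompact_Icc (a := r) (b := R)).exists_bound_of_continuousOn
    hκ.continuous.continuousOn
  refine ⟨max B 0, le_max_right _ _, fun ρ => ?_⟩
  rcases le_or_gt ρ r with h | h
  · rw [hκ.eq_zero_of_le ρ h]; exact le_max_right _ _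
  rcases le_or_gt R ρ with h' | h'
  · rw [hκ.eq_zero_of_ge ρ h']; exact le_max_right _ _
  exact (le_abs_self _).trans ((hB ρ ⟨h.le, h'.le⟩).trans (le_max_left _ _))

lemma isRotaBaxterKernel (hκ : RadialBump r R κ) : ∃ M, IsRotaBaxterKernel (bumpKernel κ) M := by
  obtain ⟨B, hB0, hB⟩ := hκ.exists_bound
  have hmeas : Measurable (Function.uncurry (bumpKernel κ)) := by
    have := hκ.continuous.measurable
    unfold bumpKernel Function.uncurry
    fun_prop
  let J : ℂ → ℝ := (closedBall (0 : ℂ) 1).indicator fun w => ‖w‖⁻¹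
  let χ : ℂ → ℝ := (closedBall (0 : ℂ) 1).indicator fun _ => 2
  have hJ : Integrable J := integrableOn_norm_inv.integrable_indicator measurableSet_closedBall
  have hχ : Integrable χ :=
    (integrableOn_const (isCompact_closedBall (0 : ℂ) 1).measure_lt_top.ne).integrable_indicator
      measurableSet_closedBall
  have hJ0 : ∀ w, 0 ≤ J w := fun w => Set.indicator_nonneg (fun _ _ => by positivity) _
  have hχ0 : ∀ w, 0 ≤ χ w := fun w => Set.indicator_nonneg (fun _ _ => by positivity) _
  let D : ℂ → ℂ → ℝ := fun z w => B / Real.pi * (χ w + J (w - z))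
  have hD : ∀ z, Integrable (D z) := fun z => (hχ.add (hJ.comp_sub_right z)).const_mul _
  have hπ := Real.pi_pos
  have hle : ∀ z w, ‖bumpKernel κ z w‖ ≤ D z w := by
    intro z w
    have hD0 : 0 ≤ D z w := mul_nonneg (by positivity) (add_nonneg (hχ0 _) (hJ0 _))
    rcases eq_or_ne w z with rfl | hwz
    · simpa [bumpKernel] using hD0
    rcases le_or_gt R ‖w‖ with hw | hw
    · simpa [bumpKernel, hκ.eq_zero_of_ge _ hw] using hD0
    have hw1 : ‖w‖ ≤ 1 := hw.le.trans hκ.lt_one.le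
    have hχw : χ w = 2 := Set.indicator_of_mem (by simpa using hw1) _
    have hinv : ‖w - z‖⁻¹ ≤ 1 + J (w - z) := by
      by_cases h : w - z ∈ closedBall (0 : ℂ) 1
      · have : J (w - z) = ‖w - z‖⁻¹ := Set.indicator_of_mem h _
        linarith
      · have h1 : 1 < ‖w - z‖ := by simpa using h
        exact (inv_le_one_of_one_le₀ h1.le).trans (by linarith [hJ0 (w - z)])
    have e : z * w / (w - z) = w * (w * (w - z)⁻¹ - 1) := by
      have : w - z ≠ 0 := sub_ne_zero.2 hwz
      field_simp
      ring
    rw [bumpKernel, norm_mul, Complex.norm_real, Real.norm_of_nonneg (by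
      have := hκ.nonneg ‖w‖; positivity), e, norm_mul]
    refine mul_le_mul (by have := hB ‖w‖; gcongr) ?_ (by positivity) (by positivity)
    calc ‖w‖ * ‖w * (w - z)⁻¹ - 1‖ ≤ 1 * (‖w‖ * ‖w - z‖⁻¹ + 1) := by
          gcongr
          refine (norm_sub_le _ _).trans ?_
          simp
      _ ≤ 1 * (1 * ‖w - z‖⁻¹ + 1) := by gcongr
      _ ≤ _ := by rw [hχw]; linarith
  have hint : ∀ z, Integrable (bumpKernel κ z) := fun z =>
    (hD z).mono' (hmeas.comp measurable_prodMk_left).aestronglyMeasurable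
      (ae_of_all _ (hle z))
  refine ⟨B / Real.pi * ((∫ w, χ w) + ∫ w, J w), hmeas, hint, fun z => ?_, ?_⟩
  · refine (integral_mono (hint z).norm (hD z) (hle z)).trans_eq ?_
    simp only [D]
    rw [integral_const_mul, integral_add hχ (hJ.comp_sub_right z), integral_sub_right_eq_self J z]
  · intro z w ζ h1 h2 h3
    have h1' := sub_ne_zero.2 h1
    have h1'' := sub_ne_zero.2 h1.symm
    have h2' := sub_ne_zero.2 h2.symm
    have h3' := sub_ne_zero.2 h3.symm
    unfold bumpKernel
    rw [← neg_sub w ζ]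
    field_simp
    ring

lemma continuous_kernelOp (hκ : RadialBump r R κ) {p : ℂ → ℂ} (hp : Continuous p) :
    Continuous (kernelOp (bumpKernel κ) p) := by
  have hli : LocallyIntegrable (fun w : ℂ => w⁻¹) := by
    refine locallyIntegrable_of_norm_le_rpow (C := 1) (α := 1) (by simp) (by simp)
      (ae_of_all _ fun x => ?_) (by fun_prop)
    simp [Real.rpow_neg_one]
  let g : ℂ → ℂ := fun w => (κ ‖w‖ : ℝ) * w * p w
  have hg : Continuous g := by
    have := hκ.continuous
    fun_prop
  have hgs : HasCompactSupport g := by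
    refine HasCompactSupport.intro (isCompact_closedBall (0 : ℂ) R) fun w hw => ?_
    have : R ≤ ‖w‖ := (by simpa using hw : R < ‖w‖).le
    simp [g, hκ.eq_zero_of_ge _ this]
  have hconv := hgs.continuous_convolution_right (ContinuousLinearMap.mul ℂ ℂ) hli hg
  have e : kernelOp (bumpKernel κ) p = fun z => -(z / Real.pi)
      * convolution (fun w : ℂ => w⁻¹) g (ContinuousLinearMap.mul ℂ ℂ) volume z := by
    funext z
    rw [convolution_eq_swap, ← integral_const_mul, kernelOp]
    congr 1
    funext w
    simp only [bumpKernel, g, ContinuousLinearMap.mul_apply']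
    rw [← neg_sub w z, inv_neg]
    push_cast
    ring
  rw [e]
  fun_prop

lemma differentiableOn_kernelOp (hκ : RadialBump r R κ) {p : ℂ → ℂ} (hp : BddMeasurable p) :
    DifferentiableOn ℂ (kernelOp (bumpKernel κ) p) (ball 0 r) := by
  intro z₀ hz₀
  obtain ⟨M, hN⟩ := hκ.isRotaBaxterKernel
  obtain ⟨B, hB0, hB⟩ := hκ.exists_bound
  obtain ⟨C, hC⟩ := hp.bounded
  have hC0 : 0 ≤ C := (norm_nonneg _).trans (hC 0)
  rw [mem_ball_zero_iff] at hz₀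
  obtain ⟨r', hr', hr'r⟩ := exists_between hz₀
  have hd : 0 < r - r' := sub_pos.2 hr'r
  have hπ := Real.pi_pos
  have hκm := hκ.continuous.measurable
  have hpm := hp.measurable
  let F' : ℂ → ℂ → ℂ := fun z w => (κ ‖w‖ / Real.pi : ℝ) * (w ^ 2 / (w - z) ^ 2) * p w
  let b : ℂ → ℝ := (closedBall (0 : ℂ) 1).indicator
    fun _ => B / Real.pi * (1 / (r - r') ^ 2) * C
  have hb : Integrable b :=
    (integrableOn_const (isCompact_closedBall (0 : ℂ) 1).measure_lt_top.ne).integrable_indicator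
      measurableSet_closedBall
  refine (hasDerivAt_integral_of_dominated_loc_of_deriv_le (s := ball 0 r') (bound := b)
    (F' := F') (isOpen_ball.mem_nhds (by simpa using hr'))
    (Eventually.of_forall fun z => (hN.integrable_mul hp z).aestronglyMeasurable)
    (hN.integrable_mul hp z₀) (by fun_prop) (ae_of_all _ fun w z hz => ?_) hb
    (ae_of_all _ fun w z hz => ?_)).2.differentiableAt.differentiableWithinAt
  · rw [mem_ball_zero_iff] at hz
    have hb0 : 0 ≤ b w := Set.indicator_nonneg (fun _ _ => by positivity) _
    rcases le_or_gt ‖w‖ r with h | h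
    · simpa [F', hκ.eq_zero_of_le _ h] using hb0
    rcases le_or_gt R ‖w‖ with h' | h'
    · simpa [F', hκ.eq_zero_of_ge _ h'] using hb0
    have hw1 : ‖w‖ ≤ 1 := h'.le.trans hκ.lt_one.le
    have hbw : b w = B / Real.pi * (1 / (r - r') ^ 2) * C :=
      Set.indicator_of_mem (by simpa using hw1) _
    have hwz : r - r' ≤ ‖w - z‖ := by
      have := norm_sub_norm_le w z
      linarith
    rw [hbw, norm_mul, norm_mul, Complex.norm_real, Real.norm_of_nonneg (by
      have := hκ.nonneg ‖w‖; positivity), norm_div, norm_pow, norm_pow]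
    have := hB ‖w‖
    have := hC w
    gcongr
    exact pow_le_one₀ (norm_nonneg _) hw1
  · rw [mem_ball_zero_iff] at hz
    rcases le_or_gt ‖w‖ r with h | h
    · simpa [F', bumpKernel, hκ.eq_zero_of_le _ h] using hasDerivAt_const z (0 : ℂ)
    have hwz : w - z ≠ 0 := sub_ne_zero.2 fun e => by rw [e] at h; linarith
    have h1 : HasDerivAt (fun z => z * w / (w - z)) (w ^ 2 / (w - z) ^ 2) z := by
      have := ((hasDerivAt_id z).mul_const w).div ((hasDerivAt_id z).const_sub w) hwz
      refine this.congr_deriv ?_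
      simp
      ring
    exact (h1.const_mul _).mul_const _

end RadialBump

end CauchyKernel

section AngularIntegral

open MeasureTheory Filter Topology Metric

lemma integral_circleMap_div_sub {z : ℂ} {ρ : ℝ} (hρ : 0 < ρ) (hz : ‖z‖ ≠ ρ) :
    ∫ θ in -Real.pi..Real.pi, circleMap 0 ρ θ / (circleMap 0 ρ θ - z)
      = if ‖z‖ < ρ then 2 * (Real.pi : ℂ) else 0 := by
  have hper : Function.Periodic (fun θ => circleMap 0 ρ θ / (circleMap 0 ρ θ - z))
      (2 * Real.pi) := fun θ => by simp only [periodic_circleMap 0 ρ θ]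
  have h1 := hper.intervalIntegral_add_eq (-Real.pi) 0
  rw [show -Real.pi + 2 * Real.pi = Real.pi by ring, zero_add] at h1
  have h2 : ∮ w in C(0, ρ), (w - z)⁻¹
      = Complex.I * ∫ θ in (0 : ℝ)..2 * Real.pi, circleMap 0 ρ θ / (circleMap 0 ρ θ - z) := by
    rw [circleIntegral_def_Icc, ← intervalIntegral.integral_const_mul,
      intervalIntegral.integral_of_le (by positivity), integral_Icc_eq_integral_Ioc]
    congr 1
    funext θ
    simp [deriv_circleMap]
    ring
  rw [h1]
  refine mul_left_cancel₀ Complex.I_ne_zero ?_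
  rw [← h2]
  split_ifs with h
  · rw [circleIntegral.integral_sub_inv_of_mem_ball (by simpa using h)]
    ring
  · have hlt : ρ < ‖z‖ := lt_of_le_of_ne (not_lt.1 h) hz.symm
    rw [mul_zero]
    have hd : ∀ w ∈ closedBall (0 : ℂ) ρ, DifferentiableAt ℂ (fun w => (w - z)⁻¹) w := by
      intro w hw
      refine (differentiableAt_id.sub_const z).inv (sub_ne_zero.2 ?_)
      rintro rfl
      exact hlt.not_ge (by simpa using hw)
    exact Complex.circleIntegral_eq_zero_of_differentiable_on_off_countable hρ.le
      Set.countable_empty (fun w hw => (hd w hw).continuousAt.continuousWithinAt)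
      fun w hw => hd w (ball_subset_closedBall hw.1)

namespace RadialBump

variable {r R : ℝ} {κ : ℝ → ℝ}

lemma kernelOp_one_eq (hκ : RadialBump r R κ) (z : ℂ) :
    kernelOp (bumpKernel κ) (fun _ => 1) z =
      ∫ ρ in Set.Ioi (0 : ℝ), 2 * z * (if ‖z‖ < ρ then (ρ * κ ρ : ℝ) else 0 : ℂ) := by
  obtain ⟨M, hN⟩ := hκ.isRotaBaxterKernel
  have hi : IntegrableOn
      (fun p : ℝ × ℝ => p.1 • bumpKernel κ z (Complex.polarCoord.symm p)) polarCoord.target := by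
    have hm : Measurable (bumpKernel κ z) := hN.measurable.comp measurable_prodMk_left
    have hms : Measurable fun p : ℝ × ℝ => Complex.polarCoord.symm p := by
      have : (fun p : ℝ × ℝ => Complex.polarCoord.symm p)
          = fun p : ℝ × ℝ => (p.1 * (Real.cos p.2 + Real.sin p.2 * Complex.I) : ℂ) := by
        funext p; exact Complex.polarCoord_symm_apply p
      rw [this]
      fun_prop
    refine ⟨(measurable_fst.smul (hm.comp hms)).aestronglyMeasurable, ?_⟩
    have h1 := Complex.lintegral_comp_polarCoord_symm fun w => ‖bumpKernel κ z w‖ₑ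
    have h2 := (hN.integrable z).2
    rw [HasFiniteIntegral, ← h1] at h2
    rw [HasFiniteIntegral]
    refine lt_of_le_of_lt (le_of_eq ?_) h2
    refine setLIntegral_congr_fun polarCoord.open_target.measurableSet fun p hp => ?_
    have hp0 : 0 < p.1 := hp.1
    rw [enorm_smul, Real.enorm_of_nonneg hp0.le, smul_eq_mul]
  simp only [kernelOp, mul_one]
  rw [← Complex.integral_comp_polarCoord_symm, polarCoord_target] at *
  rw [Measure.volume_eq_prod] at *
  rw [setIntegral_prod _ hi]
  have hne : ∀ᵐ ρ : ℝ, ρ ≠ ‖z‖ := by simp [ae_iff]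
  refine setIntegral_congr_ae measurableSet_Ioi ?_
  filter_upwards [hne] with ρ hρ hρ0
  have hρ0 : 0 < ρ := hρ0
  have e : ∀ θ : ℝ, ρ • bumpKernel κ z (Complex.polarCoord.symm (ρ, θ))
      = (ρ * κ ρ / Real.pi : ℝ) * z * (circleMap 0 ρ θ / (circleMap 0 ρ θ - z)) := by
    intro θ
    have : Complex.polarCoord.symm (ρ, θ) = circleMap 0 ρ θ := by
      rw [Complex.polarCoord_symm_apply, circleMap, Complex.exp_mul_I]
      simp
    rw [this, bumpKernel, norm_circleMap_zero, abs_of_pos hρ0, Complex.real_smul]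
    push_cast
    ring
  simp only [e]
  rw [integral_const_mul, ← integral_Ioc_eq_integral_Ioo,
    ← intervalIntegral.integral_of_le (by linarith [Real.pi_pos]),
    integral_circleMap_div_sub hρ0 hρ.symm]
  split_ifs
  · have : (Real.pi : ℂ) ≠ 0 := by exact_mod_cast Real.pi_ne_zero
    push_cast
    field_simp
  · simp

lemma integral_profile (hκ : RadialBump r R κ) :
    ∫ ρ in Set.Ioi (0 : ℝ), ((ρ * κ ρ : ℝ) : ℂ) = 1 / 2 := by
  rw [integral_complex_ofReal, hκ.integral_eq]
  norm_num

lemma kernelOp_one_of_le (hκ : RadialBump r R κ) {z : ℂ} (hz : ‖z‖ ≤ r) :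
    kernelOp (bumpKernel κ) (fun _ => 1) z = z := by
  rw [hκ.kernelOp_one_eq, integral_const_mul]
  have e : (fun ρ : ℝ => (if ‖z‖ < ρ then (ρ * κ ρ : ℝ) else 0 : ℂ))
      = fun ρ : ℝ => ((ρ * κ ρ : ℝ) : ℂ) := by
    funext ρ
    split_ifs with h
    · rfl
    · simp [hκ.eq_zero_of_le ρ ((not_lt.1 h).trans hz)]
  rw [e, hκ.integral_profile]
  ring

lemma norm_kernelOp_one_le (hκ : RadialBump r R κ) (z : ℂ) :
    ‖kernelOp (bumpKernel κ) (fun _ => 1) z‖ ≤ R := by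
  rw [hκ.kernelOp_one_eq, integral_const_mul]
  rcases le_or_gt R ‖z‖ with hz | hz
  · have e : (fun ρ : ℝ => (if ‖z‖ < ρ then (ρ * κ ρ : ℝ) else 0 : ℂ)) = fun _ => 0 := by
      funext ρ
      split_ifs with h
      · simp [hκ.eq_zero_of_ge ρ (hz.trans h.le)]
      · rfl
    rw [e]
    simpa using (hκ.pos.trans hκ.lt).le
  · have hi : IntegrableOn (fun ρ : ℝ => ρ * κ ρ) (Set.Ioi 0) := by
      by_contra h
      have h1 := hκ.integral_eq
      rw [integral_undef h] at h1
      norm_num at h1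
    have h2 : ‖∫ ρ in Set.Ioi (0 : ℝ), (if ‖z‖ < ρ then (ρ * κ ρ : ℝ) else 0 : ℂ)‖ ≤ 1 / 2 := by
      rw [← hκ.integral_eq]
      refine norm_integral_le_of_norm_le hi ?_
      refine (ae_restrict_mem measurableSet_Ioi).mono fun ρ hρ => ?_
      have h0 : 0 ≤ ρ * κ ρ := mul_nonneg (le_of_lt hρ) (hκ.nonneg ρ)
      split_ifs
      · rw [Complex.norm_real, Real.norm_of_nonneg h0]
      · simpa using h0
    rw [norm_mul, norm_mul, Complex.norm_two]
    have := norm_nonneg z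
    nlinarith

end RadialBump

end AngularIntegral

section FiniteExtension

open MeasureTheory Filter Topology Metric
open scoped BoundedContinuousFunction

lemma bddMeasurable_quotient {F f g : ℂ → ℂ} {L : ℝ} (hF : Continuous F) (hf : Continuous f)
    (hg : Continuous g) (hL : ∀ w, ‖F w‖ ≤ L * ‖f w - g w‖) :
    BddMeasurable (fun w => F w / (f w - g w)) ∧ (∀ w, ‖F w / (f w - g w)‖ ≤ max L 0) ∧
      ∀ w, F w / (f w - g w) * (f w - g w) = F w := by
  have hb : ∀ w, ‖F w / (f w - g w)‖ ≤ max L 0 := fun w => by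
    rw [norm_div]
    exact div_le_of_le_mul₀ (norm_nonneg _) (le_max_right _ _)
      ((hL w).trans (mul_le_mul_of_nonneg_right (le_max_left _ _) (norm_nonneg _)))
  refine ⟨⟨hF.measurable.div (hf.measurable.sub hg.measurable), _, hb⟩, hb, fun w => ?_⟩
  refine div_mul_cancel_of_imp fun h => ?_
  have := hL w
  rw [h, norm_zero, mul_zero] at this
  exact norm_le_zero_iff.1 this

variable {N : ℂ → ℂ → ℂ} {M : ℝ} {P : ℂ → ℂ → ℂ} {D L : ℝ}

/-- Solvability of the nonlinear equation `f = w₀ + S (P (·, f))`. -/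
lemma IsRotaBaxterKernel.exists_solution (hN : IsRotaBaxterKernel N M)
    (hNc : ∀ p, Continuous p → Continuous (kernelOp N p))
    (hPc : ∀ f : ℂ → ℂ, Continuous f → Continuous fun w => P w (f w))
    (hPD : ∀ w ζ, ‖P w ζ‖ ≤ D) (hPL : ∀ w ζ η, ‖P w ζ - P w η‖ ≤ L * ‖ζ - η‖) (w₀ : ℂ) :
    ∃ f : ℂ → ℂ, Continuous f ∧ (∃ C, ∀ z, ‖f z‖ ≤ C) ∧
      ∀ z, f z = w₀ + kernelOp N (fun w => P w (f w)) z := by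
  have hbm : ∀ f : ℂ →ᵇ ℂ, BddMeasurable fun w => P w (f w) := fun f =>
    ⟨(hPc f f.continuous).measurable, D, fun w => hPD w _⟩
  let Θ : (ℂ →ᵇ ℂ) → (ℂ →ᵇ ℂ) := fun f =>
    BoundedContinuousFunction.ofNormedAddCommGroup (kernelOp N fun w => P w (f w))
      (hNc _ (hPc f f.continuous)) (M * D) (hN.norm_kernelOp_le (hbm f) fun w => hPD w _)
  have hΘ : ∀ f z, Θ f z = kernelOp N (fun w => P w (f w)) z := fun _ _ => rfl
  set A := max L 0
  have hA0 : 0 ≤ A := le_max_right _ _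
  have hM0 := hN.nonneg
  have hLip : ∀ f g : ℂ →ᵇ ℂ, ∀ w, ‖P w (f w) - P w (g w)‖ ≤ A * ‖f - g‖ := fun f g w =>
    (hPL w _ _).trans (mul_le_mul (le_max_left _ _) ((f - g).norm_coe_le_norm w) (norm_nonneg _)
      hA0)
  have hΘL : ∀ f g, ‖Θ f - Θ g‖ ≤ M * A * ‖f - g‖ := fun f g => by
    rw [BoundedContinuousFunction.norm_le (by positivity)]
    intro z
    rw [BoundedContinuousFunction.coe_sub, Pi.sub_apply, hΘ, hΘ,
      ← hN.kernelOp_sub (hbm f) (hbm g), mul_assoc]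
    exact hN.norm_kernelOp_le ((hbm f).sub (hbm g)) (hLip f g) z
  have hΘC : ∀ s ∈ Set.Icc (0 : ℝ) 1, ∀ f g : ℂ →ᵇ ℂ,
      ‖f - g‖ ≤ (1 + Real.exp (M * A) * (M * (A * Real.exp (M * A)))) *
        ‖(f - s • Θ f) - (g - s • Θ g)‖ := fun s hs f g => by
    set k := (f - s • Θ f) - (g - s • Θ g)
    rw [BoundedContinuousFunction.norm_le (by positivity)]
    obtain ⟨ha, haL, hau⟩ := bddMeasurable_quotient
      (F := fun w => (s : ℂ) * (P w (f w) - P w (g w))) (L := L)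
      (continuous_const.mul ((hPc f f.continuous).sub (hPc g g.continuous)))
      f.continuous g.continuous (fun w => by
        rw [norm_mul, Complex.norm_real, Real.norm_of_nonneg hs.1]
        exact (mul_le_of_le_one_left (norm_nonneg _) hs.2).trans (hPL w _ _))
    have hbd : ∀ h : ℂ →ᵇ ℂ, BddMeasurable h := fun h =>
      ⟨h.continuous.measurable, ‖h‖, h.norm_coe_le_norm⟩
    refine hN.norm_le_of_eq_add ha (hbd (f - g)) (hbd k) haL k.norm_coe_le_norm fun z => ?_
    simp only [BoundedContinuousFunction.coe_sub, Pi.sub_apply, hau]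
    rw [kernelOp_const_mul, hN.kernelOp_sub (hbm f) (hbm g)]
    simp only [k, BoundedContinuousFunction.coe_sub, Pi.sub_apply,
      BoundedContinuousFunction.coe_smul, hΘ, Complex.real_smul]
    ring
  obtain ⟨f, hf⟩ := exists_sub_smul_eq hΘL hΘC (BoundedContinuousFunction.const ℂ w₀)
  refine ⟨f, f.continuous, ⟨‖f‖, f.norm_coe_le_norm⟩, fun z => ?_⟩
  have h := congrArg (fun k : ℂ →ᵇ ℂ => k z) hf
  simp only [BoundedContinuousFunction.coe_sub, Pi.sub_apply, hΘ,
    BoundedContinuousFunction.const_apply] at h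
  exact sub_eq_iff_eq_add.1 h

/-- Two solutions with distinct values at the basepoint never meet. -/
lemma IsRotaBaxterKernel.solution_ne (hN : IsRotaBaxterKernel N M)
    (hPc : ∀ f : ℂ → ℂ, Continuous f → Continuous fun w => P w (f w))
    (hPD : ∀ w ζ, ‖P w ζ‖ ≤ D) (hPL : ∀ w ζ η, ‖P w ζ - P w η‖ ≤ L * ‖ζ - η‖)
    {f g : ℂ → ℂ} {a b : ℂ} (hab : a ≠ b) (hf : Continuous f) (hg : Continuous g)
    (hfb : ∃ C, ∀ z, ‖f z‖ ≤ C) (hgb : ∃ C, ∀ z, ‖g z‖ ≤ C)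
    (hfa : ∀ z, f z = a + kernelOp N (fun w => P w (f w)) z)
    (hgb' : ∀ z, g z = b + kernelOp N (fun w => P w (g w)) z) (z : ℂ) : f z ≠ g z := by
  have hbm : ∀ f : ℂ → ℂ, Continuous f → BddMeasurable fun w => P w (f w) := fun f hf =>
    ⟨(hPc f hf).measurable, D, fun w => hPD w _⟩
  obtain ⟨ha, -, hau⟩ := bddMeasurable_quotient (F := fun w => P w (f w) - P w (g w))
    ((hPc f hf).sub (hPc g hg)) hf hg fun w => hPL w _ _
  refine sub_ne_zero.1 (hN.ne_zero_of_eq_const_add (u := fun w => f w - g w) ha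
    (BddMeasurable.sub ⟨hf.measurable, hfb⟩ ⟨hg.measurable, hgb⟩)
    (sub_ne_zero.2 hab) (fun z => ?_) z)
  simp only [hau]
  rw [hN.kernelOp_sub (hbm f hf) (hbm g hg)]
  linear_combination hfa z - hgb' z

/-- A finite disjoint family of holomorphic graphs over the unit disk can be enlarged, over any
smaller disk, by a graph through a prescribed point. -/
lemma exists_disjoint_of_finset (F : Finset (ℂ → ℂ))
    (hF : ∀ f ∈ F, DifferentiableOn ℂ f (ball 0 1))
    (hd : ∀ f ∈ F, ∀ g ∈ F, f ≠ g → ∀ l ∈ ball (0 : ℂ) 1, f l ≠ g l) {w₀ : ℂ}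
    (hw₀ : ∀ f ∈ F, w₀ ≠ f 0) {r : ℝ} (hr : 0 < r) (hr1 : r < 1) :
    ∃ f : ℂ → ℂ, DifferentiableOn ℂ f (ball 0 r) ∧ f 0 = w₀ ∧
      ∀ g ∈ F, ∀ l ∈ ball (0 : ℂ) r, f l ≠ g l := by
  obtain ⟨R, hrR, hR1⟩ := exists_between hr1
  obtain ⟨κ, hκ⟩ := exists_radialBump hr hrR hR1
  obtain ⟨M, hN⟩ := hκ.isRotaBaxterKernel
  set N := bumpKernel κ
  set φ := kernelOp N fun _ => 1 with hφ
  have hφc : Continuous φ := hκ.continuous_kernelOp continuous_const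
  have hφR : ∀ z, φ z ∈ closedBall (0 : ℂ) R := fun z => by
    simpa using hκ.norm_kernelOp_one_le z
  have hsub : closedBall (0 : ℂ) R ⊆ ball 0 1 := closedBall_subset_ball hR1
  have hφ1 : ∀ z, φ z ∈ ball (0 : ℂ) 1 := fun z => hsub (hφR z)
  have hchain := fun g (hg : g ∈ F) => hN.comp_kernelOp (BddMeasurable.const 1)
    hκ.norm_kernelOp_one_le hR1 (hF g hg)
  simp only [one_mul] at hchain
  have hgc : ∀ g ∈ F, Continuous fun w => g (φ w) := fun g hg =>
    (hF g hg).continuousOn.comp_continuous hφc hφ1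
  have hgc' : ∀ g ∈ F, Continuous fun w => deriv g (φ w) := fun g hg =>
    ((hF g hg).deriv isOpen_ball).continuousOn.comp_continuous hφc hφ1
  obtain ⟨D, hD0, hD⟩ : ∃ D : ℝ, 0 ≤ D ∧ ∀ g ∈ F, ∀ z, ‖deriv g (φ z)‖ ≤ D := by
    have : ∀ᶠ D : ℝ in atTop, ∀ g ∈ F, ∀ z, ‖deriv g (φ z)‖ ≤ D := by
      rw [eventually_all_finset]
      intro g hg
      obtain ⟨C, hC⟩ := (hchain g hg).1.bounded
      filter_upwards [eventually_ge_atTop C] with D hD z using (hC z).trans hD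
    exact ((eventually_ge_atTop 0).and this).exists
  obtain ⟨δ, hδ0, hδ⟩ : ∃ δ : ℝ, 0 < δ ∧
      ∀ f ∈ F, ∀ g ∈ F, f ≠ g → ∀ z, δ ≤ ‖f (φ z) - g (φ z)‖ := by
    have : ∀ᶠ δ : ℝ in 𝓝[>] 0, ∀ f ∈ F, ∀ g ∈ F, f ≠ g → ∀ z, δ ≤ ‖f (φ z) - g (φ z)‖ := by
      rw [eventually_all_finset]
      intro f hf
      rw [eventually_all_finset]
      intro g hg
      by_cases hfg : f = g
      · simp [hfg]
      obtain ⟨x, hx, hmin⟩ := (isCompact_closedBall (0 : ℂ) R).exists_isMinOn ⟨_, hφR 0⟩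
        (((hF f hf).sub (hF g hg)).continuousOn.mono hsub).norm
      have hpos : 0 < ‖(f - g) x‖ := norm_pos_iff.2 (sub_ne_zero.2 (hd f hf g hg hfg x (hsub hx)))
      filter_upwards [Ioo_mem_nhdsGT hpos] with δ hδ _ z using hδ.2.le.trans (hmin (hφR z))
    exact ((eventually_mem_nhdsWithin).and this).exists
  let P : ℂ → ℂ → ℂ := fun w ζ =>
    ∑ g ∈ F, deriv g (φ w) * (max 0 (1 - ‖ζ - g (φ w)‖ / δ) : ℝ)
  have hPc : ∀ f : ℂ → ℂ, Continuous f → Continuous fun w => P w (f w) := fun f hf => by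
    refine continuous_finsetSum _ fun g hg => ?_
    have h1 := hgc g hg
    have h2 := hgc' g hg
    exact h2.mul (Complex.continuous_ofReal.comp
      (continuous_const.max (continuous_const.sub ((hf.sub h1).norm.div_const δ))))
  have hPD : ∀ w ζ, ‖P w ζ‖ ≤ F.card • D := fun w ζ => by
    refine (norm_sum_le _ _).trans (Finset.sum_le_card_nsmul _ _ _ fun g hg => ?_)
    rw [norm_mul, Complex.norm_real, Real.norm_of_nonneg (le_max_left _ _)]
    refine (mul_le_of_le_one_right (norm_nonneg _) (max_le zero_le_one ?_)).trans (hD g hg w)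
    have : 0 ≤ ‖ζ - g (φ w)‖ / δ := by positivity
    linarith
  have hPL : ∀ w ζ η, ‖P w ζ - P w η‖ ≤ F.card • (D / δ) * ‖ζ - η‖ := fun w ζ η => by
    simp only [P]
    rw [← Finset.sum_sub_distrib, smul_mul_assoc]
    refine (norm_sum_le _ _).trans (Finset.sum_le_card_nsmul _ _ _ fun g hg => ?_)
    rw [← mul_sub, norm_mul, ← Complex.ofReal_sub, Complex.norm_real, Real.norm_eq_abs,
      div_mul_eq_mul_div, mul_div_assoc]
    refine mul_le_mul (hD g hg w) ?_ (abs_nonneg _) hD0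
    refine (abs_max_sub_max_le_max _ _ _ _).trans ?_
    rw [sub_self, abs_zero, sub_sub_sub_cancel_left, ← sub_div, abs_div, abs_of_pos hδ0]
    refine max_le (by positivity) ?_
    gcongr
    refine (abs_norm_sub_norm_le _ _).trans (le_of_eq ?_)
    rw [sub_sub_sub_cancel_right, norm_sub_rev]
  have hPg : ∀ g ∈ F, ∀ w, P w (g (φ w)) = deriv g (φ w) := fun g hg w => by
    simp only [P]
    rw [Finset.sum_eq_single g]
    · simp
    · intro f hf hfg
      have h1 : 1 ≤ ‖g (φ w) - f (φ w)‖ / δ := (one_le_div hδ0).2 (hδ g hg f hf hfg.symm w)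
      rw [max_eq_left (by linarith)]
      simp
    · exact fun h => absurd hg h
  obtain ⟨f, hfc, hfb, hf⟩ := hN.exists_solution (fun p => hκ.continuous_kernelOp) hPc hPD hPL w₀
  refine ⟨f, ?_, ?_, fun g hg l hl => ?_⟩
  · have h1 := hκ.differentiableOn_kernelOp (p := fun w => P w (f w))
      ⟨(hPc f hfc).measurable, _, fun w => hPD w _⟩
    exact (h1.const_add w₀).congr fun z _ => hf z
  · rw [hf]
    simp [kernelOp, N, bumpKernel]
  · have hlφ : φ l = l := hκ.kernelOp_one_of_le (by simpa using (mem_ball_zero_iff.1 hl).le)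
    have h := hN.solution_ne hPc hPD hPL (hw₀ g hg) hfc (hgc g hg) hfb ?_ hf (fun z => ?_) l
    · simpa only [hlφ] using h
    · obtain ⟨C, hC⟩ := (isCompact_closedBall (0 : ℂ) R).exists_bound_of_continuousOn
        ((hF g hg).continuousOn.mono hsub)
      exact ⟨C, fun z => hC _ (hφR z)⟩
    · simp only [hPg g hg]
      exact (hchain g hg).2 z

end FiniteExtension

section Schottky

open Metric Filter Topology

/-- A weak form of Bloch's theorem: a holomorphic function on a disk whose image contains no disk
of radius `B` has a controlled derivative. -/
lemma sub_norm_mul_norm_deriv_le {g : ℂ → ℂ} {R ρ B : ℝ} (hg : DifferentiableOn ℂ g (ball 0 R))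
    (hB : ∀ a, ∃ q, dist q a < B ∧ ∀ z ∈ ball (0 : ℂ) R, g z ≠ q) (hρ : 0 ≤ ρ) (hρR : ρ < R)
    {z : ℂ} (hz : z ∈ closedBall 0 ρ) : (ρ - ‖z‖) * ‖deriv g z‖ ≤ 48 * B := by
  have hB0 : 0 ≤ B := by
    obtain ⟨q, hq, -⟩ := hB 0
    exact dist_nonneg.trans hq.le
  have hsub : closedBall (0 : ℂ) ρ ⊆ ball 0 R := closedBall_subset_ball hρR
  have hg' : DifferentiableOn ℂ (deriv g) (ball 0 R) := hg.deriv isOpen_ball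
  obtain ⟨p, hp, hmax⟩ := (isCompact_closedBall (0 : ℂ) ρ).exists_isMaxOn
    ⟨0, mem_closedBall_self hρ⟩ (f := fun z => (ρ - ‖z‖) * ‖deriv g z‖)
    ((continuous_const.sub continuous_norm).continuousOn.mul (hg'.continuousOn.mono hsub).norm)
  refine (hmax hz).trans ?_
  set d := ‖deriv g p‖ with hd
  change (ρ - ‖p‖) * d ≤ 48 * B
  rw [mem_closedBall_zero_iff] at hp
  rcases hp.eq_or_lt with h | hpρ
  · rw [h, sub_self, zero_mul]
    positivity
  rcases (norm_nonneg (deriv g p)).eq_or_lt with h | hd0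
  · rw [hd, ← h, mul_zero]
    positivity
  obtain ⟨t, ht⟩ : ∃ t, t = (ρ - ‖p‖) / 2 := ⟨_, rfl⟩
  have ht0 : 0 < t := by linarith
  have htp : ∀ z ∈ ball p t, ‖z‖ < ‖p‖ + t := fun z hz => by
    have := norm_sub_norm_le z p
    rw [mem_ball_iff_norm] at hz
    linarith
  have htR : ball p t ⊆ ball 0 R := fun z hz => by
    have := htp z hz
    rw [mem_ball_zero_iff]
    linarith
  have hder : Set.MapsTo (deriv g) (ball p t) (closedBall (deriv g p) (3 * d)) := fun z hz => by
    have h1 := htp z hz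
    have h2 : (ρ - ‖z‖) * ‖deriv g z‖ ≤ (ρ - ‖p‖) * d :=
      hmax (mem_closedBall_zero_iff.2 (by linarith))
    have h3 : ‖deriv g z‖ ≤ 2 * d := by
      by_contra! h
      nlinarith
    rw [mem_closedBall_iff_norm]
    exact (norm_sub_le _ _).trans (by linarith)
  have hs6 : closedBall p (t / 6) ⊆ ball p t := closedBall_subset_ball (by linarith)
  have hk : ∀ z ∈ closedBall p (t / 6), ‖deriv (fun w => g w - deriv g p * w) z‖ ≤ d / 2 :=
      fun z hz => by
    have hdz := (hg.differentiableAt (isOpen_ball.mem_nhds (htR (hs6 hz)))).hasDerivAt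
    have hdk : HasDerivAt (fun w => g w - deriv g p * w) (deriv g z - deriv g p) z :=
      (hdz.sub ((hasDerivAt_id' z).const_mul (deriv g p))).congr_deriv (by rw [mul_one])
    rw [hdk.deriv, ← dist_eq_norm]
    refine (Complex.dist_le_div_mul_dist_of_mapsTo_ball (hg'.mono htR) hder (hs6 hz)).trans ?_
    rw [mem_closedBall] at hz
    refine (mul_le_mul_of_nonneg_left hz (by positivity)).trans (le_of_eq ?_)
    field_simp
    ring_nf
  have hsphere : ∀ z ∈ sphere p (t / 6), d * t / 12 ≤ ‖g z - g p‖ := fun z hz => by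
    have h := (convex_closedBall p (t / 6)).norm_image_sub_le_of_norm_deriv_le
      (f := fun w => g w - deriv g p * w) (fun w hw =>
        (hg.differentiableAt (isOpen_ball.mem_nhds (htR (hs6 hw)))).sub
          (differentiableAt_id.const_mul (deriv g p))) hk
      (mem_closedBall_self (by positivity)) (sphere_subset_closedBall hz)
    rw [mem_sphere_iff_norm] at hz
    rw [hz] at h
    have h2 := norm_sub_norm_le (deriv g p * (z - p)) (g z - g p)
    rw [norm_mul, hz, norm_sub_rev (deriv g p * (z - p)), ← hd] at h2
    have h3 : (g z - deriv g p * z) - (g p - deriv g p * p)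
        = g z - g p - deriv g p * (z - p) := by ring
    rw [h3] at h
    linarith
  have himg := DiffContOnCl.ball_subset_image_closedBall
    (((hg.mono (hs6.trans htR)).mono closure_ball_subset_closedBall).diffContOnCl)
    (by positivity : 0 < t / 6) hsphere
    (((hg.differentiableAt (isOpen_ball.mem_nhds (htR (mem_ball_self ht0)))).hasDerivAt.eventually_ne
      (norm_pos_iff.1 hd0)).frequently.filter_mono nhdsWithin_le_nhds)
  obtain ⟨q, hq, hq'⟩ := hB (g p)
  have hle : d * t / 12 / 2 ≤ dist q (g p) := by
    by_contra! h
    obtain ⟨z, hz, hzq⟩ := himg (mem_ball.2 h)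
    exact hq' z (htR (hs6 hz)) hzq
  have : ρ - ‖p‖ = 2 * t := by linarith
  rw [this]
  linarith

/-- Holomorphic logarithm on a disk with a prescribed value at the centre. -/
lemma exists_differentiableOn_exp_eq {U : ℂ → ℂ} {R : ℝ} (hU : DifferentiableOn ℂ U (ball 0 R))
    (hU0 : ∀ z ∈ ball 0 R, U z ≠ 0) {l : ℂ} (hl : Complex.exp l = U 0) :
    ∃ G : ℂ → ℂ, DifferentiableOn ℂ G (ball 0 R) ∧ G 0 = l ∧
      ∀ z ∈ ball 0 R, Complex.exp (G z) = U z := by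
  obtain ⟨G, hG0, hG⟩ := (((hU.deriv isOpen_ball).div hU hU0).isExactOn_ball).with_val_at 0 l
  refine ⟨G, fun z hz => (hG z hz).differentiableAt.differentiableWithinAt, hG0, fun z hz => ?_⟩
  have hR : (0 : ℂ) ∈ ball (0 : ℂ) R := mem_ball_self (dist_nonneg.trans_lt hz)
  have hd : ∀ z ∈ ball 0 R, HasDerivAt (fun w => U w * Complex.exp (-G w)) 0 z := fun z hz => by
    have h1 := (hU.differentiableAt (isOpen_ball.mem_nhds hz)).hasDerivAt
    refine (h1.mul (hG z hz).neg.cexp).congr_deriv ?_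
    have := hU0 z hz
    simp only [Pi.div_apply]
    field_simp
    ring
  have h := (convex_ball (0 : ℂ) R).norm_image_sub_le_of_norm_deriv_le (C := 0)
    (fun w hw => (hd w hw).differentiableAt) (fun w hw => by rw [(hd w hw).deriv, norm_zero]) hR hz
  rw [zero_mul] at h
  have h2 := sub_eq_zero.1 (norm_le_zero_iff.1 h)
  rw [hG0, ← hl, Complex.exp_neg, Complex.exp_neg, mul_inv_cancel₀ (Complex.exp_ne_zero _)] at h2
  exact (eq_of_div_eq_one (by rw [div_eq_mul_inv, h2])).symm

/-- Holomorphic inverse cosine on a disk with a prescribed value at the centre. -/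
lemma exists_differentiableOn_cos_eq {u : ℂ → ℂ} {R : ℝ} (hu : DifferentiableOn ℂ u (ball 0 R))
    (hu1 : ∀ z ∈ ball 0 R, u z ≠ 1 ∧ u z ≠ -1) {a : ℂ} (ha : u 0 = Complex.cos (Real.pi * a)) :
    ∃ F : ℂ → ℂ, DifferentiableOn ℂ F (ball 0 R) ∧ F 0 = a ∧
      ∀ z ∈ ball 0 R, u z = Complex.cos (Real.pi * F z) := by
  rcases le_or_gt R 0 with hR | hR
  · refine ⟨fun _ => a, differentiableOn_const _, rfl, ?_⟩
    simp [ball_eq_empty.2 hR]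
  have h0 : (0 : ℂ) ∈ ball (0 : ℂ) R := mem_ball_self hR
  have hpi : (Real.pi : ℂ) ≠ 0 := Complex.ofReal_ne_zero.2 Real.pi_ne_zero
  have hU0 : ∀ z ∈ ball 0 R, 1 - u z ^ 2 ≠ 0 := fun z hz h => by
    have : (1 - u z) * (1 + u z) = 0 := by linear_combination h
    rcases mul_eq_zero.1 this with h | h
    · exact (hu1 z hz).1 (sub_eq_zero.1 h).symm
    · exact (hu1 z hz).2 (by linear_combination h)
  have hsc : 1 - u 0 ^ 2 = Complex.sin (Real.pi * a) ^ 2 := by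
    rw [ha]
    linear_combination -Complex.sin_sq_add_cos_sq (Real.pi * a)
  have hs : Complex.sin (Real.pi * a) ≠ 0 := fun h => hU0 0 h0 (by rw [hsc, h]; ring)
  obtain ⟨G, hG, hGa, hGe⟩ := exists_differentiableOn_exp_eq (U := fun z => 1 - u z ^ 2)
    (l := 2 * Complex.log (Complex.sin (Real.pi * a))) ((differentiableOn_const _).sub (hu.pow 2))
    hU0 (by rw [hsc, two_mul, Complex.exp_add, Complex.exp_log hs]; ring)
  set v : ℂ → ℂ := fun z => Complex.exp (G z / 2) with hv
  have hvd : DifferentiableOn ℂ v (ball 0 R) := (hG.div_const 2).cexp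
  have hv2 : ∀ z ∈ ball 0 R, v z ^ 2 = 1 - u z ^ 2 := fun z hz => by
    rw [← hGe z hz, hv, ← Complex.exp_nat_mul]
    congr 1
    push_cast
    ring
  have hprod : ∀ z ∈ ball 0 R, (u z + v z * Complex.I) * (u z - v z * Complex.I) = 1 :=
    fun z hz => by linear_combination hv2 z hz - v z ^ 2 * Complex.I_sq
  obtain ⟨E, hE, hEa, hEe⟩ := exists_differentiableOn_exp_eq (U := fun z => u z + v z * Complex.I)
    (l := Real.pi * a * Complex.I) (hu.add (hvd.mul_const _))
    (fun z hz => left_ne_zero_of_mul_eq_one (hprod z hz)) (by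
      have : v 0 = Complex.sin (Real.pi * a) := by
        rw [hv]
        simp only [hGa]
        rw [mul_div_cancel_left₀ _ two_ne_zero, Complex.exp_log hs]
      rw [this, ha, Complex.exp_mul_I])
  refine ⟨fun z => E z / (Real.pi * Complex.I), hE.div_const _, ?_, fun z hz => ?_⟩
  · simp only [hEa]
    have := Complex.I_ne_zero
    field_simp
  · have h1 : Real.pi * (E z / (Real.pi * Complex.I)) * Complex.I = E z := by
      have := Complex.I_ne_zero
      field_simp
    rw [Complex.cos, neg_mul, h1, Complex.exp_neg, hEe z hz,
      inv_eq_of_mul_eq_one_right (hprod z hz)]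
    ring

/-- Near every real number `y` there is `t` with `cosh (π t)` an integer. -/
lemma exists_cosh_pi_mul_eq_natCast {y : ℝ} (hy : 0 ≤ y) :
    ∃ t ∈ Set.Icc y (y + 1), ∃ n : ℕ, Real.cosh (Real.pi * t) = n := by
  have hpi := Real.pi_gt_three
  have h1 : Real.cosh (Real.pi * y) + 1 ≤ Real.cosh (Real.pi * (y + 1)) := by
    rw [mul_add, Real.cosh_add, mul_one]
    have hc := Real.one_le_cosh (Real.pi * y)
    have hs : 0 ≤ Real.sinh (Real.pi * y) := Real.sinh_nonneg_iff.2 (by positivity)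
    have hs' : 0 ≤ Real.sinh Real.pi := Real.sinh_nonneg_iff.2 (by positivity)
    have h2 : 2 ≤ Real.cosh Real.pi := by
      have := Real.add_one_le_exp Real.pi
      have := Real.exp_pos (-Real.pi)
      rw [Real.cosh_eq]
      linarith
    nlinarith [mul_nonneg hs hs']
  have hle : (⌈Real.cosh (Real.pi * y)⌉₊ : ℝ) ∈
      Set.Icc (Real.cosh (Real.pi * y)) (Real.cosh (Real.pi * (y + 1))) :=
    ⟨Nat.le_ceil _, (Nat.ceil_lt_add_one (Real.cosh_pos _).le).le.trans h1⟩
  obtain ⟨t, ht, hte⟩ := intermediate_value_Icc (f := fun t => Real.cosh (Real.pi * t))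
    (by linarith) (by fun_prop) hle
  exact ⟨t, ht, _, hte⟩

lemma exists_dist_lt_cos_cos_eq (a : ℂ) :
    ∃ q, dist q a < 2 ∧ ∃ n : ℤ, Complex.cos (Real.pi * q) = n := by
  obtain ⟨t, ht, n, hn⟩ := exists_cosh_pi_mul_eq_natCast (abs_nonneg a.im)
  obtain ⟨s, hs, hsa⟩ : ∃ s : ℝ, Real.cosh (Real.pi * s) = n ∧ |s - a.im| ≤ 1 := by
    rcases le_total 0 a.im with h | h
    · rw [abs_of_nonneg h] at ht
      exact ⟨t, hn, abs_le.2 ⟨by linarith [ht.1], by linarith [ht.2]⟩⟩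
    · rw [abs_of_nonpos h] at ht
      exact ⟨-t, by rw [mul_neg, Real.cosh_neg, hn], abs_le.2 ⟨by linarith [ht.2], by linarith [ht.1]⟩⟩
  refine ⟨(round a.re : ℂ) + s * Complex.I, ?_, ?_⟩
  · rw [dist_eq_norm]
    refine (Complex.norm_le_abs_re_add_abs_im _).trans_lt ?_
    have := abs_sub_round a.re
    rw [abs_sub_comm] at this
    simp
    linarith
  · have h1 : (Real.pi : ℂ) * (round a.re + s * Complex.I)
        = round a.re * Real.pi + (Real.pi * s) * Complex.I := by ring
    have h2 : Complex.cosh (Real.pi * s) = n := by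
      rw [← Complex.ofReal_mul, ← Complex.ofReal_cosh, hs, Complex.ofReal_natCast]
    rw [h1, Complex.cos_add_mul_I, Complex.sin_int_mul_pi, h2, zero_mul, zero_mul, sub_zero]
    have h3 := Complex.sin_sq_add_cos_sq (round a.re * Real.pi)
    rw [Complex.sin_int_mul_pi, zero_pow two_ne_zero, zero_add, sq_eq_one_iff] at h3
    rcases h3 with h | h
    · exact ⟨n, by rw [h, one_mul, Int.cast_natCast]⟩
    · exact ⟨-n, by rw [h, neg_one_mul, Int.cast_neg, Int.cast_natCast]⟩

/-- Schottky's theorem, without an explicit bound. -/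
lemma exists_norm_le_of_omits (w : ℂ) {ρ R : ℝ} (hρ : 0 ≤ ρ) (hρR : ρ < R) :
    ∃ C, ∀ f : ℂ → ℂ, DifferentiableOn ℂ f (ball 0 R) →
      (∀ z ∈ ball 0 R, f z ≠ 0 ∧ f z ≠ 1) → f 0 = w → ∀ z ∈ closedBall 0 ρ, ‖f z‖ ≤ C := by
  have hpi : (Real.pi : ℂ) ≠ 0 := Complex.ofReal_ne_zero.2 Real.pi_ne_zero
  have hsurj : ∀ w, ∃ a, Complex.cos (Real.pi * a) = w := fun w => by
    obtain ⟨x, hx⟩ := Complex.cos_surjective w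
    exact ⟨x / Real.pi, by rw [mul_div_cancel₀ _ hpi, hx]⟩
  obtain ⟨a, ha⟩ := hsurj (2 * w - 1)
  obtain ⟨b, hb⟩ := hsurj a
  set c : ℂ → ℂ := fun x => (1 + Complex.cos (Real.pi * Complex.cos (Real.pi * x))) / 2 with hc
  obtain ⟨C, hC⟩ := (isCompact_closedBall b (48 * 2 / ((R - ρ) / 2) * ρ)).exists_bound_of_continuousOn
    (f := c) (by fun_prop)
  refine ⟨C, fun f hf hf01 hfw z hz => ?_⟩
  obtain ⟨F, hF, hFa, hFe⟩ := exists_differentiableOn_cos_eq (u := fun z => 2 * f z - 1) (a := a)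
    ((hf.const_mul 2).sub_const 1) (fun z hz => ⟨fun h => (hf01 z hz).2 (by linear_combination h / 2),
      fun h => (hf01 z hz).1 (by linear_combination h / 2)⟩) (by simp only [hfw, ha])
  have hFZ : ∀ z ∈ ball 0 R, ∀ n : ℤ, F z ≠ n := fun z hz n h => by
    have h1 := hFe z hz
    rw [h] at h1
    have h2 : Complex.sin (Real.pi * n) = 0 := by rw [mul_comm, Complex.sin_int_mul_pi]
    have h3 := Complex.sin_sq_add_cos_sq (Real.pi * n)
    rw [h2, ← h1] at h3
    have h4 : f z * (f z - 1) = 0 := by linear_combination h3 / 4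
    rcases mul_eq_zero.1 h4 with h | h
    · exact (hf01 z hz).1 h
    · exact (hf01 z hz).2 (sub_eq_zero.1 h)
  obtain ⟨g, hg, hgb, hge⟩ := exists_differentiableOn_cos_eq (a := b) hF
    (fun z hz => ⟨by simpa using hFZ z hz 1, by simpa using hFZ z hz (-1)⟩) (by rw [hFa, hb])
  have hfg : f z = c (g z) := by
    have hz' := closedBall_subset_ball hρR hz
    rw [hc]
    simp only
    rw [← hge z hz', ← hFe z hz']
    ring
  rw [hfg]
  have hB : ∀ a, ∃ q, dist q a < 2 ∧ ∀ z ∈ ball (0 : ℂ) R, g z ≠ q := fun a => by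
    obtain ⟨q, hq, n, hn⟩ := exists_dist_lt_cos_cos_eq a
    exact ⟨q, hq, fun z hz h => hFZ z hz n (by rw [hge z hz, h, hn])⟩
  refine hC _ ?_
  have hder : ∀ z ∈ closedBall (0 : ℂ) ρ, ‖deriv g z‖ ≤ 48 * 2 / ((R - ρ) / 2) := fun z hz => by
    have h1 := sub_norm_mul_norm_deriv_le (ρ := (R + ρ) / 2) hg hB (by linarith) (by linarith)
      (closedBall_subset_closedBall (by linarith) hz)
    rw [le_div_iff₀ (by linarith), mul_comm]
    rw [mem_closedBall_zero_iff] at hz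
    exact (mul_le_mul_of_nonneg_right (by linarith) (norm_nonneg _)).trans h1
  have h := (convex_closedBall (0 : ℂ) ρ).norm_image_sub_le_of_norm_deriv_le
    (fun w hw => hg.differentiableAt (isOpen_ball.mem_nhds (closedBall_subset_ball hρR hw))) hder
    (mem_closedBall_self hρ) hz
  rw [mem_closedBall_iff_norm, ← hgb]
  refine h.trans (mul_le_mul_of_nonneg_left ?_ (div_nonneg (by norm_num) (by linarith)))
  rw [sub_zero]
  exact mem_closedBall_zero_iff.1 hz

end Schottky

section NormalFamilies

open Metric Filter Topology

/-- An ultrafilter limit of locally bounded holomorphic functions on the disk. -/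
lemma exists_differentiableOn_tendsto {ι : Type*} (U : Ultrafilter ι) {f : ι → ℂ → ℂ}
    (hf : ∀ ρ ∈ Set.Ioo (0 : ℝ) 1, ∃ C, ∀ᶠ i in (U : Filter ι),
      DifferentiableOn ℂ (f i) (ball 0 ρ) ∧ ∀ z ∈ ball 0 ρ, ‖f i z‖ ≤ C) :
    ∃ g : ℂ → ℂ, DifferentiableOn ℂ g (ball 0 1) ∧
      ∀ z ∈ ball 0 1, Tendsto (fun i => f i z) U (𝓝 (g z)) := by
  have hex : ∀ z ∈ ball (0 : ℂ) 1, ∃ ρ ∈ Set.Ioo (0 : ℝ) 1, z ∈ ball 0 ρ := fun z hz => by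
    rw [mem_ball_zero_iff] at hz
    obtain ⟨ρ, h1, h2⟩ := exists_between hz
    exact ⟨ρ, ⟨(norm_nonneg z).trans_lt h1, h2⟩, mem_ball_zero_iff.2 h1⟩
  have hlim : ∀ z, ∃ a, z ∈ ball (0 : ℂ) 1 → Tendsto (fun i => f i z) U (𝓝 a) := fun z => by
    by_cases hz : z ∈ ball (0 : ℂ) 1
    · obtain ⟨ρ, hρ, hzρ⟩ := hex z hz
      obtain ⟨C, hC⟩ := hf ρ hρ
      obtain ⟨a, -, ha⟩ := (isCompact_closedBall (0 : ℂ) C).ultrafilter_le_nhds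
        (U.map fun i => f i z) (by
          rw [Ultrafilter.coe_map, le_principal_iff, mem_map]
          filter_upwards [hC] with i hi using mem_closedBall_zero_iff.2 (hi.2 z hzρ))
      exact ⟨a, fun _ => ha⟩
    · exact ⟨0, fun h => absurd h hz⟩
  choose g hg using hlim
  refine ⟨g, fun z hz => ?_, hg⟩
  obtain ⟨ρ, hρ, hzρ⟩ := hex z hz
  obtain ⟨C, hC⟩ := hf ρ hρ
  have hsub : ball (0 : ℂ) ρ ⊆ ball 0 1 := ball_subset_ball hρ.2.le
  suffices TendstoLocallyUniformlyOn f g U (ball 0 ρ) from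
    ((this.differentiableOn (hC.mono fun i hi => hi.1) isOpen_ball).differentiableAt
      (isOpen_ball.mem_nhds hzρ)).differentiableWithinAt
  rw [Metric.tendstoLocallyUniformlyOn_iff]
  intro ε hε x hx
  have hs : 0 < ρ - ‖x‖ := sub_pos.2 (mem_ball_zero_iff.1 hx)
  have hxs : ball x (ρ - ‖x‖) ⊆ ball 0 ρ := ball_subset_ball' (by simp)
  set K := 2 * C / (ρ - ‖x‖) with hK
  have hLip : ∀ᶠ i in (U : Filter ι), ∀ y ∈ ball x (ρ - ‖x‖), dist (f i y) (f i x) ≤ K * dist y x := by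
    filter_upwards [hC] with i hi y hy
    refine Complex.dist_le_div_mul_dist_of_mapsTo_ball (hi.1.mono hxs) (fun w hw => ?_) hy
    rw [mem_closedBall, two_mul]
    refine (dist_le_norm_add_norm _ _).trans (add_le_add (hi.2 w (hxs hw)) (hi.2 x hx))
  have hLip' : ∀ y ∈ ball x (ρ - ‖x‖), dist (g y) (g x) ≤ K * dist y x := fun y hy =>
    le_of_tendsto ((hg y (hsub (hxs hy))).dist (hg x (hsub hx))) (hLip.mono fun i hi => hi y hy)
  have hKy : ∀ᶠ y in 𝓝 x, K * dist y x < ε / 3 := by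
    have : Tendsto (fun y => K * dist y x) (𝓝 x) (𝓝 (K * dist x x)) :=
      (continuous_const.mul (continuous_id.dist continuous_const)).continuousAt
    rw [dist_self, mul_zero] at this
    exact this.eventually_lt_const (by positivity)
  refine ⟨{y | K * dist y x < ε / 3} ∩ ball x (ρ - ‖x‖),
    mem_nhdsWithin_of_mem_nhds (inter_mem hKy (ball_mem_nhds x hs)), ?_⟩
  filter_upwards [hLip, Metric.tendsto_nhds.1 (hg x (hsub hx)) (ε / 3) (by positivity)]
    with i hi hix y hy
  have h1 := hi y hy.2
  have h2 := hLip' y hy.2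
  have h3 : K * dist y x < ε / 3 := hy.1
  have h4 := dist_triangle4 (g y) (g x) (f i x) (f i y)
  rw [dist_comm (g x) (f i x), dist_comm (f i x) (f i y)] at h4
  linarith

/-- Quantitative disjointness of three disjoint graphs, with constants depending only on the
values at the centre. -/
lemma exists_norm_sub_le_mul (w x₀ y₀ : ℂ) {ρ R : ℝ} (hρ : 0 ≤ ρ) (hρR : ρ < R) :
    ∃ C, ∀ f x y : ℂ → ℂ, DifferentiableOn ℂ f (ball 0 R) → DifferentiableOn ℂ x (ball 0 R) →
      DifferentiableOn ℂ y (ball 0 R) → (∀ z ∈ ball 0 R, f z ≠ x z) → (∀ z ∈ ball 0 R, f z ≠ y z) →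
      (∀ z ∈ ball 0 R, y z ≠ x z) → f 0 = w → x 0 = x₀ → y 0 = y₀ → ∀ z ∈ closedBall 0 ρ,
      ‖f z - x z‖ ≤ C * ‖y z - x z‖ ∧ ‖y z - x z‖ ≤ C * ‖f z - x z‖ := by
  obtain ⟨C₁, hC₁⟩ := exists_norm_le_of_omits ((w - x₀) / (y₀ - x₀)) hρ hρR
  obtain ⟨C₂, hC₂⟩ := exists_norm_le_of_omits ((y₀ - x₀) / (w - x₀)) hρ hρR
  refine ⟨max C₁ C₂, fun f x y hf hx hy hfx hfy hyx hf0 hx0 hy0 z hz => ?_⟩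
  have hz' := closedBall_subset_ball hρR hz
  have h1 := hC₁ (fun z => (f z - x z) / (y z - x z))
    ((hf.sub hx).div (hy.sub hx) fun z hz => sub_ne_zero.2 (hyx z hz))
    (fun z hz => ⟨div_ne_zero (sub_ne_zero.2 (hfx z hz)) (sub_ne_zero.2 (hyx z hz)), fun h =>
      hfy z hz (sub_left_injective ((div_eq_one_iff_eq (sub_ne_zero.2 (hyx z hz))).1 h))⟩)
    (by rw [hf0, hx0, hy0]) z hz
  have h2 := hC₂ (fun z => (y z - x z) / (f z - x z))
    ((hy.sub hx).div (hf.sub hx) fun z hz => sub_ne_zero.2 (hfx z hz))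
    (fun z hz => ⟨div_ne_zero (sub_ne_zero.2 (hyx z hz)) (sub_ne_zero.2 (hfx z hz)), fun h =>
      hfy z hz (sub_left_injective ((div_eq_one_iff_eq (sub_ne_zero.2 (hfx z hz))).1 h)).symm⟩)
    (by rw [hf0, hx0, hy0]) z hz
  rw [norm_div, div_le_iff₀ (norm_pos_iff.2 (sub_ne_zero.2 (hyx z hz')))] at h1
  rw [norm_div, div_le_iff₀ (norm_pos_iff.2 (sub_ne_zero.2 (hfx z hz')))] at h2
  exact ⟨h1.trans (by gcongr; exact le_max_left _ _), h2.trans (by gcongr; exact le_max_right _ _)⟩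

/-- Disjoint holomorphic graphs over the disk leave room for one more graph through every
remaining point of the central fibre. -/
lemma exists_disjoint {F : Set (ℂ → ℂ)} (hF : ∀ f ∈ F, DifferentiableOn ℂ f (ball 0 1))
    (hd : ∀ f ∈ F, ∀ g ∈ F, f ≠ g → ∀ l ∈ ball (0 : ℂ) 1, f l ≠ g l) {w₀ : ℂ}
    (hw₀ : ∀ f ∈ F, w₀ ≠ f 0) :
    ∃ f : ℂ → ℂ, DifferentiableOn ℂ f (ball 0 1) ∧ f 0 = w₀ ∧
      ∀ g ∈ F, ∀ l ∈ ball (0 : ℂ) 1, f l ≠ g l := by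
  classical
  rcases F.subsingleton_or_nontrivial with hs | hnt
  · rcases hs.eq_empty_or_singleton with rfl | ⟨f, rfl⟩
    · exact ⟨fun _ => w₀, differentiableOn_const _, rfl, by simp⟩
    · refine ⟨fun z => f z + (w₀ - f 0), (hF f rfl).add_const _, add_sub_cancel _ _, ?_⟩
      rintro _ rfl l -
      exact fun h => hw₀ _ rfl (sub_eq_zero.1 (add_eq_left.1 h))
  set r : ℕ → ℝ := fun n => 1 - 1 / ((n : ℝ) + 2) with hr
  have hr0 : ∀ n, 0 < r n := fun n => by
    rw [hr, sub_pos, div_lt_one (by positivity)]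
    have : (0 : ℝ) ≤ n := n.cast_nonneg
    linarith
  have hr1 : ∀ n, r n < 1 := fun n => sub_lt_self _ (by positivity)
  have hrt : ∀ ρ < 1, ∀ᶠ n in atTop, ρ < r n := fun ρ hρ => by
    have h : Tendsto (fun n : ℕ => 1 - 1 / ((n : ℝ) + 2)) atTop (𝓝 (1 - 0)) :=
      tendsto_const_nhds.sub (tendsto_const_nhds.div_atTop
        (tendsto_atTop_add_const_right _ _ tendsto_natCast_atTop_atTop))
    rw [sub_zero] at h
    exact h.eventually_const_lt hρ
  have hex : ∀ i : Finset F × ℕ, ∃ f : ℂ → ℂ, DifferentiableOn ℂ f (ball 0 (r i.2)) ∧ f 0 = w₀ ∧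
      ∀ g ∈ i.1, ∀ l ∈ ball (0 : ℂ) (r i.2), f l ≠ (g : ℂ → ℂ) l := fun i => by
    obtain ⟨f, h1, h2, h3⟩ := exists_disjoint_of_finset (F := i.1.image Subtype.val) (w₀ := w₀)
      (fun f hf => by
        obtain ⟨f, -, rfl⟩ := Finset.mem_image.1 hf
        exact hF f f.2)
      (fun f hf g hg => by
        obtain ⟨f, -, rfl⟩ := Finset.mem_image.1 hf
        obtain ⟨g, -, rfl⟩ := Finset.mem_image.1 hg
        exact hd f f.2 g g.2)
      (fun f hf => by
        obtain ⟨f, -, rfl⟩ := Finset.mem_image.1 hf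
        exact hw₀ f f.2) (hr0 i.2) (hr1 i.2)
    exact ⟨f, h1, h2, fun g hg => h3 g (Finset.mem_image_of_mem _ hg)⟩
  choose f hf hf0 hfd using hex
  let U : Ultrafilter (Finset F × ℕ) := Ultrafilter.of atTop
  have hU : (U : Filter (Finset F × ℕ)) ≤ atTop := Ultrafilter.of_le _
  have hball : ∀ ρ < 1, ∀ᶠ i in (U : Filter (Finset F × ℕ)), ball (0 : ℂ) ρ ⊆ ball 0 (r i.2) :=
    fun ρ hρ => hU (by
      rw [← prod_atTop_atTop_eq]
      filter_upwards [(hrt ρ hρ).prod_inr atTop] with i hi using ball_subset_ball hi.le)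
  have hmem : ∀ x : F, ∀ᶠ i in (U : Filter (Finset F × ℕ)), x ∈ i.1 := fun x => hU (by
    rw [← prod_atTop_atTop_eq]
    filter_upwards [(eventually_ge_atTop {x}).prod_inl atTop] with i hi using
      hi (Finset.mem_singleton_self x))
  have hkey : ∀ ρ ∈ Set.Ioo (0 : ℝ) 1, ∀ x y : F, x ≠ y → ∃ C,
      ∀ᶠ i in (U : Filter (Finset F × ℕ)), ∀ z ∈ closedBall (0 : ℂ) ρ,
        ‖f i z - x.1 z‖ ≤ C * ‖y.1 z - x.1 z‖ ∧ ‖y.1 z - x.1 z‖ ≤ C * ‖f i z - x.1 z‖ := by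
    intro ρ hρ x y hxy
    obtain ⟨R, hρR, hR⟩ := exists_between hρ.2
    obtain ⟨C, hC⟩ := exists_norm_sub_le_mul w₀ (x.1 0) (y.1 0) hρ.1.le hρR
    have hsub : ball (0 : ℂ) R ⊆ ball 0 1 := ball_subset_ball hR.le
    refine ⟨C, ?_⟩
    filter_upwards [hball R hR, hmem x, hmem y] with i hi hix hiy
    exact hC (f i) x y ((hf i).mono hi) ((hF x x.2).mono hsub) ((hF y y.2).mono hsub)
      (fun z hz => hfd i x hix z (hi hz)) (fun z hz => hfd i y hiy z (hi hz))
      (fun z hz => hd y y.2 x x.2 (fun h => hxy (Subtype.ext h).symm) z (hsub hz)) (hf0 i) rfl rfl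
  obtain ⟨x, hx, y, hy, hxy⟩ := hnt
  obtain ⟨g, hg, hlim⟩ := exists_differentiableOn_tendsto U (f := f) fun ρ hρ => by
    obtain ⟨C, hC⟩ := hkey ρ hρ ⟨x, hx⟩ ⟨y, hy⟩ (fun h => hxy (congrArg Subtype.val h))
    have hsub := closedBall_subset_ball (x := (0 : ℂ)) hρ.2
    obtain ⟨B, hB⟩ := (isCompact_closedBall (0 : ℂ) ρ).exists_bound_of_continuousOn
      (f := fun z => C * ‖y z - x z‖ + ‖x z‖)
      ((continuousOn_const.mul (((hF y hy).continuousOn.sub (hF x hx).continuousOn).mono hsub).norm).add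
        ((hF x hx).continuousOn.mono hsub).norm)
    refine ⟨B, ?_⟩
    filter_upwards [hball ρ hρ.2, hC] with i hi hiC
    refine ⟨(hf i).mono hi, fun z hz => ?_⟩
    have hz' := ball_subset_closedBall hz
    have h1 := (Real.le_norm_self _).trans (hB z hz')
    have h2 := (hiC z hz').1
    have h3 := norm_sub_norm_le (f i z) (x z)
    linarith
  refine ⟨g, hg, tendsto_nhds_unique (hlim 0 (mem_ball_self one_pos)) ?_, fun a ha l hl h => ?_⟩
  · simp only [hf0]
    exact tendsto_const_nhds
  · obtain ⟨b, hb, hba⟩ := (show F.Nontrivial from ⟨x, hx, y, hy, hxy⟩).exists_ne a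
    rw [mem_ball_zero_iff] at hl
    obtain ⟨ρ, hlρ, hρ⟩ := exists_between hl
    obtain ⟨C, hC⟩ := hkey ρ ⟨(norm_nonneg l).trans_lt hlρ, hρ⟩ ⟨a, ha⟩ ⟨b, hb⟩
      (fun h => hba (congrArg Subtype.val h).symm)
    have hl1 := mem_ball_zero_iff.2 hl
    have hle : ‖b l - a l‖ ≤ C * ‖g l - a l‖ :=
      ge_of_tendsto (((hlim l hl1).sub_const (a l)).norm.const_mul C)
        (hC.mono fun i hi => (hi l (mem_closedBall_zero_iff.2 hlρ.le)).2)
    rw [h, sub_self, norm_zero, mul_zero] at hle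
    exact hd b hb a ha hba l hl1 (sub_eq_zero.1 (norm_le_zero_iff.1 hle))

end NormalFamilies

section Extension

open Metric

/-- A family of functions, holomorphic on the unit disk and zero elsewhere, whose graphs over the
disk are pairwise disjoint. -/
def IsDisjointFamily (F : Set (ℂ → ℂ)) : Prop :=
  (∀ f ∈ F, DifferentiableOn ℂ f (ball 0 1) ∧ ∀ l ∉ ball (0 : ℂ) 1, f l = 0) ∧
    ∀ f ∈ F, ∀ g ∈ F, f ≠ g → ∀ l ∈ ball (0 : ℂ) 1, f l ≠ g l

lemma IsDisjointFamily.exists_maximal {F : Set (ℂ → ℂ)} (hF : IsDisjointFamily F) :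
    ∃ G, F ⊆ G ∧ Maximal IsDisjointFamily G := by
  refine zorn_subset_nonempty {G | IsDisjointFamily G} (fun c hc hchain hne => ?_) F hF
  refine ⟨⋃₀ c, ⟨fun f ⟨G, hG, hf⟩ => (hc hG).1 f hf, fun f ⟨G, hG, hf⟩ g ⟨G', hG', hg⟩ => ?_⟩,
    fun G hG => Set.subset_sUnion_of_mem hG⟩
  rcases hchain.total hG hG' with h | h
  · exact (hc hG').2 f (h hf) g hg
  · exact (hc hG).2 f hf g (h hg)

lemma IsDisjointFamily.exists_apply_zero_eq {F : Set (ℂ → ℂ)} (hF : Maximal IsDisjointFamily F)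
    (w : ℂ) : ∃ f ∈ F, f 0 = w := by
  classical
  by_contra! hw
  have h0 : (0 : ℂ) ∈ ball (0 : ℂ) 1 := mem_ball_self one_pos
  obtain ⟨f, hf, hf0, hfd⟩ := exists_disjoint (fun f hf => (hF.prop.1 f hf).1) hF.prop.2
    (w₀ := w) fun f hf => (hw f hf).symm
  set f' := (ball (0 : ℂ) 1).indicator f
  have hff : Set.EqOn f' f (ball 0 1) := fun l hl => Set.indicator_of_mem hl f
  have hins : IsDisjointFamily (insert f' F) := by
    refine ⟨?_, ?_⟩
    · rintro g (rfl | hg)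
      · exact ⟨hf.congr hff, fun l hl => Set.indicator_of_notMem hl f⟩
      · exact hF.prop.1 g hg
    · rintro g (rfl | hg) k (rfl | hk) hgk l hl
      · exact absurd rfl hgk
      · rw [hff hl]
        exact hfd k hk l hl
      · rw [hff hl]
        exact (hfd g hg l hl).symm
      · exact hF.prop.2 g hg k hk hgk l hl
  exact hw f' (hF.le_of_ge hins (Set.subset_insert _ _) (Set.mem_insert _ _)) ((hff h0).trans hf0)

end Extension

/-- **Słodkowski's extended λ-lemma.** Every holomorphic motion `h` of
`X ⊆ ℂ` over `𝔻` extends to a holomorphic motion `H` of the whole complex plane over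
`𝔻`, with `H l x = h l x` for all `l ∈ 𝔻` and `x ∈ X`. -/
theorem stmt_16 (X : Set ℂ) (h : ℂ → ℂ → ℂ) (hh : IsHolomorphicMotion X h) :
    ∃ H : ℂ → ℂ → ℂ,
      IsHolomorphicMotion Set.univ H ∧
      ∀ l ∈ Metric.ball (0 : ℂ) 1, ∀ x ∈ X, H l x = h l x := by
  obtain ⟨hh0, hinj, hhol⟩ := hh
  have h0 : (0 : ℂ) ∈ Metric.ball (0 : ℂ) 1 := Metric.mem_ball_self one_pos
  let e : ℂ → ℂ → ℂ := fun x => (Metric.ball (0 : ℂ) 1).indicator fun l => h l x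
  have he : ∀ x, ∀ l ∈ Metric.ball (0 : ℂ) 1, e x l = h l x := fun x l hl =>
    Set.indicator_of_mem hl _
  have hX : IsDisjointFamily (e '' X) := by
    refine ⟨?_, ?_⟩
    · rintro _ ⟨x, hx, rfl⟩
      exact ⟨(hhol x hx).congr (he x), fun l hl => Set.indicator_of_notMem hl _⟩
    · rintro _ ⟨x, hx, rfl⟩ _ ⟨y, hy, rfl⟩ hxy l hl hl'
      rw [he x l hl, he y l hl] at hl'
      exact hxy (congrArg e (hinj l hl hx hy hl'))
  obtain ⟨F, hXF, hF⟩ := hX.exists_maximal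
  choose k hkF hk0 using IsDisjointFamily.exists_apply_zero_eq hF
  refine ⟨fun l x => k x l, ⟨fun x _ => hk0 x, fun l hl x _ y _ hxy => ?_,
    fun x _ => (hF.prop.1 _ (hkF x)).1⟩, fun l hl x hx => ?_⟩
  · by_contra hne
    exact hF.prop.2 _ (hkF x) _ (hkF y) (fun hk => hne (by rw [← hk0 x, ← hk0 y, hk])) l hl hxy
  · have hkx : k x = e x := by
      by_contra hne
      exact hF.prop.2 _ (hkF x) _ (hXF ⟨x, hx, rfl⟩) hne 0 h0 (by rw [hk0, he x 0 h0, hh0 x hx])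
    exact (congrFun hkx l).trans (he x l hl)
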